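/- arXiv:1509.07346 — 3 statements merged into one kernel-verified Lean document; each statement's English description precedes it below -/
import Mathlib

section
/- Let G = (A, B, E) be a bipartite graph with |A| = k ≤ n = |B| that is a normalized matching graph (i.e., for all X ⊆ A, |X|/|A| ≤ |Γ(X)|/|B|). Then the number of subsets V ∈ B^(k) (k-element subsets of B) such that G contains a complete matching from A onto V is at least sqrt(C(n,k)). In particular the number of complete matchings from A into B is at least sqrt(C(n,k)). -/
section Helpers
open Finset

/-- maximal motion inside a polyhedron -/
lemma max_motion {ι : Type*} [Fintype ι] (a s : ι → ℝ) (ha : ∀ c, 0 ≤ a c)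
    (h0 : ∀ c, a c = 0 → s c = 0) (hneg : ∃ c, s c < 0) :
    ∃ t : ℝ, 0 < t ∧ (∀ c, 0 ≤ a c + t * s c) ∧ ∃ c, a c ≠ 0 ∧ a c + t * s c = 0 := by
  classical
  obtain ⟨c1, hc1⟩ := hneg
  obtain ⟨c, hc, hmin⟩ := Finset.exists_min_image (univ.filter (fun c => s c < 0))
    (fun c => a c / (- s c)) ⟨c1, by simp [hc1]⟩
  simp only [mem_filter, mem_univ, true_and] at hc hmin
  have hac : 0 < a c := lt_of_le_of_ne (ha c) (fun h => by have := h0 c h.symm; linarith)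
  refine ⟨a c / (- s c), div_pos hac (by linarith), fun d => ?_, c, hac.ne', ?_⟩
  · by_cases hd : s d < 0
    · have h := hmin d hd
      rw [le_div_iff₀ (by linarith)] at h
      linarith
    · push Not at hd
      have : 0 ≤ a c / (- s c) := (div_pos hac (by linarith)).le
      have := mul_nonneg this hd
      linarith [ha d]
  · have : s c ≠ 0 := hc.ne
    field_simp
    ring

/-- neighborhood -/
noncomputable def nbh {α β : Type*} [Fintype β] (E : α → β → Prop) (X : Finset α) : Finset β := by
  classical exact Finset.univ.filter (fun j => ∃ i ∈ X, E i j)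

lemma mem_nbh {α β : Type*} [Fintype β] (E : α → β → Prop) (X : Finset α) (b : β) :
    b ∈ nbh E X ↔ ∃ i ∈ X, E i b := by
  simp [nbh]

/-- constant terms of the constraints -/
noncomputable def cst {α β : Type*} : β ⊕ β ⊕ Finset α → ℝ
  | Sum.inl _ => 0
  | Sum.inr (Sum.inl _) => 1
  | Sum.inr (Sum.inr X) => - (X.card : ℝ)

/-- linear parts of the constraints -/
noncomputable def lin {α β : Type*} [Fintype β] (E : α → β → Prop) (p : β → ℝ) :
    β ⊕ β ⊕ Finset α → ℝ
  | Sum.inl b => p b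
  | Sum.inr (Sum.inl b) => - p b
  | Sum.inr (Sum.inr X) => ∑ b ∈ nbh E X, p b

lemma lin_add {α β : Type*} [Fintype β] (E : α → β → Prop) (p d : β → ℝ) (t : ℝ)
    (c : β ⊕ β ⊕ Finset α) : lin E (p + t • d) c = lin E p c + t * lin E d c := by
  rcases c with b | b | X <;> simp [lin, Finset.sum_add_distrib, Finset.mul_sum]
  ring

/-- the base polytope -/
def Feas {α β : Type*} [Fintype α] [Fintype β] (E : α → β → Prop) (p : β → ℝ) : Prop :=
  (∀ c, 0 ≤ cst c + lin E p c) ∧ ∑ b, p b = (Fintype.card α : ℝ)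

lemma two_frac {β : Type*} (p : β → ℝ) (S : Finset β) (m : ℕ)
    (h0 : ∀ b, 0 ≤ p b) (h1 : ∀ b, p b ≤ 1) (hS : ∑ b ∈ S, p b = m) (i : β) (hi : i ∈ S)
    (hi0 : 0 < p i) (hi1 : p i < 1) : ∃ j ∈ S, j ≠ i ∧ 0 < p j ∧ p j < 1 := by
  classical
  by_contra! hcon
  have h01 : ∀ j ∈ S.erase i, p j = if p j = 1 then 1 else 0 := by
    intro j hj
    rw [Finset.mem_erase] at hj
    split_ifs with h
    · exact h
    · by_contra h'
      have := hcon j hj.2 hj.1 (lt_of_le_of_ne (h0 j) (Ne.symm h'))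
      exact h (le_antisymm (h1 j) this)
  have h2 : ∑ b ∈ S.erase i, p b = (((S.erase i).filter (fun b => p b = 1)).card : ℝ) := by
    rw [Finset.sum_congr rfl h01]; simp
  have h3 := Finset.add_sum_erase S p hi
  rw [hS, h2] at h3
  set q := ((S.erase i).filter (fun b => p b = 1)).card
  have ha : (q : ℝ) < m := by linarith
  have hb : (m : ℝ) < (q + 1 : ℕ) := by push_cast; linarith
  have ha' : q < m := by exact_mod_cast ha
  have hb' : m < q + 1 := by exact_mod_cast hb
  omega

/-- existence of a good direction -/
lemma exists_dir {α β : Type*} [Fintype α] [Fintype β] (E : α → β → Prop) (p : β → ℝ)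
    (hp : Feas E p) (i0 : β) (hi0 : 0 < p i0) (hi1 : p i0 < 1) :
    ∃ i j, i ≠ j ∧ 0 < p i ∧ p i < 1 ∧ 0 < p j ∧ p j < 1 ∧
      ∀ Y : Finset α, ∑ b ∈ nbh E Y, p b = Y.card → (i ∈ nbh E Y ↔ j ∈ nbh E Y) := by
  classical
  have h0 : ∀ b, 0 ≤ p b := fun b => by simpa [cst, lin] using hp.1 (Sum.inl b)
  have h1 : ∀ b, p b ≤ 1 := fun b => by simpa [cst, lin] using hp.1 (Sum.inr (Sum.inl b))
  have hX : ∀ X : Finset α, (X.card : ℝ) ≤ ∑ b ∈ nbh E X, p b := fun X => by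
    simpa [cst, lin] using hp.1 (Sum.inr (Sum.inr X))
  have huniv : ∑ b ∈ nbh E univ, p b = ((univ : Finset α).card : ℝ) := by
    apply le_antisymm _ (hX _)
    rw [Finset.card_univ, ← hp.2]
    exact Finset.sum_le_sum_of_subset_of_nonneg (Finset.subset_univ _) (fun b _ _ => h0 b)
  have hi0u : i0 ∈ nbh E (univ : Finset α) := by
    by_contra hcon
    have h2 : ∑ b ∈ insert i0 (nbh E (univ : Finset α)), p b ≤ ∑ b, p b :=
      Finset.sum_le_sum_of_subset_of_nonneg (Finset.subset_univ _) (fun b _ _ => h0 b)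
    rw [Finset.sum_insert hcon, huniv, hp.2, Finset.card_univ] at h2
    linarith
  obtain ⟨X, hXm, hmin⟩ := Finset.exists_min_image
    (univ.filter (fun X : Finset α => ∑ b ∈ nbh E X, p b = X.card ∧
      ∃ i ∈ nbh E X, 0 < p i ∧ p i < 1)) Finset.card
    ⟨univ, by simp only [mem_filter, mem_univ, true_and]; exact ⟨huniv, i0, hi0u, hi0, hi1⟩⟩
  simp only [mem_filter, mem_univ, true_and] at hXm hmin
  obtain ⟨hXt, i, hiX, hip, hip1⟩ := hXm
  obtain ⟨j, hjX, hji, hjp, hjp1⟩ := two_frac p (nbh E X) X.card h0 h1 hXt i hiX hip hip1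
  have key : ∀ i j : β, i ∈ nbh E X → j ∈ nbh E X → 0 < p i → p i < 1 → ∀ Y : Finset α,
      ∑ b ∈ nbh E Y, p b = Y.card → i ∈ nbh E Y → j ∈ nbh E Y := by
    intro i j hi hj hip hip1 Y hY hiY
    by_contra hjY
    have hun : nbh E (X ∪ Y) = nbh E X ∪ nbh E Y := by
      ext b; simp only [mem_nbh, Finset.mem_union]; grind
    have hin : nbh E (X ∩ Y) ⊆ nbh E X ∩ nbh E Y := by
      intro b; simp only [mem_nbh, Finset.mem_inter]; grind
    have e1 := Finset.sum_union_inter (s₁ := nbh E X) (s₂ := nbh E Y) (f := p)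
    have e2 : ((X ∪ Y).card : ℝ) + (X ∩ Y).card = X.card + Y.card := by
      exact_mod_cast Finset.card_union_add_card_inter X Y
    have e3 := hX (X ∪ Y)
    have e4 := hX (X ∩ Y)
    rw [hun] at e3
    have e5 : ∑ b ∈ nbh E (X ∩ Y), p b ≤ ∑ b ∈ nbh E X ∩ nbh E Y, p b :=
      Finset.sum_le_sum_of_subset_of_nonneg hin (fun b _ _ => h0 b)
    have ht : ∑ b ∈ nbh E (X ∩ Y), p b = (X ∩ Y).card := by linarith
    have hmem : i ∈ nbh E (X ∩ Y) := by
      by_contra hcon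
      have h2 : ∑ b ∈ insert i (nbh E (X ∩ Y)), p b ≤ ∑ b ∈ nbh E X ∩ nbh E Y, p b :=
        Finset.sum_le_sum_of_subset_of_nonneg
          (Finset.insert_subset (Finset.mem_inter.2 ⟨hi, hiY⟩) hin) (fun b _ _ => h0 b)
      rw [Finset.sum_insert hcon] at h2
      linarith
    have hc := hmin (X ∩ Y) ⟨ht, i, hmem, hip, hip1⟩
    have heq : X ∩ Y = X := Finset.eq_of_subset_of_card_le Finset.inter_subset_left hc
    rw [heq] at hin
    exact hjY (Finset.mem_inter.1 (hin hj)).2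
  exact ⟨i, j, hji.symm, hip, hip1, hjp, hjp1, fun Y hY =>
    ⟨key i j hiX hjX hip hip1 Y hY, key j i hjX hiX hjp hjp1 Y hY⟩⟩

/-- the exchange direction -/
noncomputable def dir {β : Type*} (i j : β) : β → ℝ := by
  classical exact fun b => if b = i then 1 else if b = j then -1 else 0

lemma dir_i {β : Type*} (i j : β) : dir i j i = 1 := by simp [dir]
lemma dir_j {β : Type*} (i j : β) (h : i ≠ j) : dir i j j = -1 := by simp [dir, h.symm]
lemma dir_o {β : Type*} (i j b : β) (h : b ≠ i) (h' : b ≠ j) : dir i j b = 0 := by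
  simp [dir, h, h']

lemma sum_dir {β : Type*} (i j : β) (h : i ≠ j) (S : Finset β) (hS : i ∈ S ↔ j ∈ S) :
    ∑ b ∈ S, dir i j b = 0 := by
  classical
  by_cases hi : i ∈ S
  · have hj := hS.1 hi
    rw [← Finset.add_sum_erase S _ hi,
      ← Finset.add_sum_erase (S.erase i) _ (Finset.mem_erase.2 ⟨h.symm, hj⟩), dir_i, dir_j i j h]
    rw [Finset.sum_eq_zero]
    · norm_num
    · intro b hb
      simp only [Finset.mem_erase] at hb
      exact dir_o i j b hb.2.1 hb.1
  · have hj : j ∉ S := fun h' => hi (hS.2 h')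
    apply Finset.sum_eq_zero
    intro b hb
    exact dir_o i j b (fun h => hi (h ▸ hb)) (fun h => hj (h ▸ hb))

/-- number of slack constraints -/
noncomputable def msr {α β : Type*} [Fintype α] [Fintype β] (E : α → β → Prop) (p : β → ℝ) : ℕ := by
  classical exact (Finset.univ.filter (fun c => cst c + lin E p c ≠ 0)).card

lemma move {α β : Type*} [Fintype α] [Fintype β] (E : α → β → Prop) (p d : β → ℝ)
    (hp : Feas E p) (hd : ∑ b, d b = 0) (h0 : ∀ c, cst c + lin E p c = 0 → lin E d c = 0)
    (hneg : ∃ c, lin E d c < 0) :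
    ∃ t : ℝ, 0 < t ∧ Feas E (p + t • d) ∧ msr E (p + t • d) < msr E p := by
  classical
  obtain ⟨t, ht, h1, c, hc, hc0⟩ := max_motion (fun c => cst c + lin E p c) (fun c => lin E d c)
    hp.1 h0 hneg
  refine ⟨t, ht, ⟨fun c => ?_, ?_⟩, ?_⟩
  · rw [lin_add, ← add_assoc]; exact h1 c
  · simp [Finset.sum_add_distrib, ← Finset.mul_sum, hd, hp.2]
  · unfold msr
    apply Finset.card_lt_card
    rw [Finset.ssubset_iff_of_subset]
    · refine ⟨c, by simpa using hc, ?_⟩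
      simp only [mem_filter, mem_univ, true_and, not_not]
      rw [lin_add, ← add_assoc]; exact hc0
    · intro e
      simp only [mem_filter, mem_univ, true_and]
      intro he he'
      apply he
      rw [lin_add, ← add_assoc, he', h0 e he']; simp

theorem pipage {α β : Type*} [Fintype α] [Fintype β] (E : α → β → Prop) (F : (β → ℝ) → ℝ)
    (hint : ∀ p, Feas E p → (∀ b, p b = 0 ∨ p b = 1) → 1 ≤ F p)
    (hconc : ∀ p i j, i ≠ j → (∀ b, 0 ≤ p b ∧ p b ≤ 1) → ∀ s t : ℝ, 0 < s → 0 < t →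
      t * F (p + s • dir i j) + s * F (p + t • (- dir i j)) ≤ (s + t) * F p) :
    ∀ p, Feas E p → 1 ≤ F p := by
  classical
  suffices H : ∀ m p, msr E p = m → Feas E p → 1 ≤ F p from fun p hp => H _ p rfl hp
  intro m
  induction m using Nat.strong_induction_on with
  | _ m ih =>
  intro p hm hp
  have h0 : ∀ b, 0 ≤ p b := fun b => by simpa [cst, lin] using hp.1 (Sum.inl b)
  have h1 : ∀ b, p b ≤ 1 := fun b => by simpa [cst, lin] using hp.1 (Sum.inr (Sum.inl b))
  by_cases hI : ∀ b, p b = 0 ∨ p b = 1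
  · exact hint p hp hI
  push Not at hI
  obtain ⟨i0, hi0, hi1⟩ := hI
  obtain ⟨i, j, hij, hi0, hi1, hj0, hj1, hY⟩ := exists_dir E p hp i0
    (lt_of_le_of_ne (h0 _) hi0.symm) (lt_of_le_of_ne (h1 _) hi1)
  have hd0 : ∑ b, dir i j b = 0 := sum_dir i j hij _ (by simp)
  have hz : ∀ b, (p b = 0 ∨ p b = 1) → dir i j b = 0 := by
    intro b hb
    apply dir_o
    · rintro rfl; rcases hb with h | h <;> linarith
    · rintro rfl; rcases hb with h | h <;> linarith
  have hl : ∀ c, cst c + lin E p c = 0 → lin E (dir i j) c = 0 := by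
    rintro (b | b | Y) h
    · simp only [cst, lin] at h ⊢
      exact hz b (Or.inl (by linarith))
    · simp only [cst, lin] at h ⊢
      rw [hz b (Or.inr (by linarith)), neg_zero]
    · simp only [cst, lin] at h ⊢
      exact sum_dir i j hij _ (hY Y (by linarith))
  have hlneg : ∀ c, lin E (- dir i j) c = - lin E (dir i j) c := by
    rintro (b | b | Y) <;> simp [lin]
  obtain ⟨s, hs, hsF, hsm⟩ := move E p (dir i j) hp hd0 hl ⟨Sum.inl j, by
    simp [lin, dir_j i j hij]⟩
  obtain ⟨t, ht, htF, htm⟩ := move E p (- dir i j) hp (by simp [hd0])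
    (fun c hc => by rw [hlneg, hl c hc, neg_zero]) ⟨Sum.inl i, by simp [lin, dir_i]⟩
  have a1 := ih _ (hm ▸ hsm) _ rfl hsF
  have a2 := ih _ (hm ▸ htm) _ rfl htF
  have a3 := hconc p i j hij (fun b => ⟨h0 b, h1 b⟩) s t hs ht
  have a4 : (s + t) * 1 ≤ (s + t) * F p := by nlinarith
  exact le_of_mul_le_mul_left a4 (by linarith)

lemma prod_conc {β : Type*} [Fintype β] (u v : β → ℝ) (huv : ∀ b x, 0 ≤ x → x ≤ 1 → 0 ≤ u b + v b * x)
    (hv : ∀ a b, 0 ≤ v a * v b) (p : β → ℝ) (i j : β) (hij : i ≠ j)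
    (hp : ∀ b, 0 ≤ p b ∧ p b ≤ 1) (s t : ℝ) (hs : 0 < s) (ht : 0 < t) :
    t * (∏ b, (u b + v b * (p + s • dir i j) b)) + s * (∏ b, (u b + v b * (p + t • (- dir i j)) b))
      ≤ (s + t) * ∏ b, (u b + v b * p b) := by
  classical
  have split : ∀ f : β → ℝ, ∏ b, f b = f i * (f j * ∏ b ∈ (univ.erase i).erase j, f b) := by
    intro f
    rw [Finset.mul_prod_erase (univ.erase i) f (by simp [hij.symm]),
      Finset.mul_prod_erase univ f (by simp)]
  rw [split, split, split]
  have r1 : ∀ r : ℝ, ∏ b ∈ (univ.erase i).erase j, (u b + v b * (p + r • dir i j) b) =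
      ∏ b ∈ (univ.erase i).erase j, (u b + v b * p b) := by
    intro r
    apply Finset.prod_congr rfl
    intro b hb
    simp only [Finset.mem_erase] at hb
    simp [dir_o i j b hb.2.1 hb.1]
  have r2 : p + t • (- dir i j) = p + (-t) • dir i j := by simp
  rw [r2, r1, r1]
  have hC : 0 ≤ ∏ b ∈ (univ.erase i).erase j, (u b + v b * p b) :=
    Finset.prod_nonneg fun b _ => huv b _ (hp b).1 (hp b).2
  generalize ∏ b ∈ (univ.erase i).erase j, (u b + v b * p b) = C at hC ⊢
  simp only [Pi.add_apply, Pi.smul_apply, dir_i, dir_j i j hij, smul_eq_mul]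
  have hpos : 0 ≤ C * (v i * v j) * (s * t * (s + t)) :=
    mul_nonneg (mul_nonneg hC (hv i j)) (by positivity)
  nlinarith [hpos]

/-- the family of matchable sets -/
noncomputable def fam {α β : Type*} [Fintype α] [Fintype β] (E : α → β → Prop) :
    Finset (Finset β) := by
  classical exact Finset.univ.filter (fun V => V.card = Fintype.card α ∧ ∃ f : α → β,
    Function.Injective f ∧ (∀ i, E i (f i)) ∧ Finset.univ.image f = V)

lemma int_mem {α β : Type*} [Fintype α] [Fintype β] (E : α → β → Prop) (p : β → ℝ)
    (hp : Feas E p) (hI : ∀ b, p b = 0 ∨ p b = 1) :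
    ∃ V ∈ fam E, ∀ b, (b ∈ V → p b = 1) ∧ (b ∉ V → p b = 0) := by
  classical
  set V := Finset.univ.filter (fun b => p b = 1) with hV
  have hpV : ∀ b, p b = if b ∈ V then 1 else 0 := by
    intro b
    rcases hI b with h | h <;> simp [hV, h]
  have hsum : ∀ S : Finset β, ∑ b ∈ S, p b = ((S ∩ V).card : ℝ) := by
    intro S
    rw [Finset.sum_congr rfl (fun b _ => hpV b)]
    simp [Finset.filter_mem_eq_inter]
  have hcard : V.card = Fintype.card α := by
    have := hp.2
    rw [hsum, Finset.univ_inter] at this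
    exact_mod_cast this
  have hall := (Finset.all_card_le_biUnion_card_iff_exists_injective
    (fun a => V.filter (fun b => E a b))).1 (by
      intro X
      have hX : (X.card : ℝ) ≤ ∑ b ∈ nbh E X, p b := by
        simpa [cst, lin] using hp.1 (Sum.inr (Sum.inr X))
      rw [hsum] at hX
      have hX' : X.card ≤ (nbh E X ∩ V).card := by exact_mod_cast hX
      refine hX'.trans (Finset.card_le_card ?_)
      intro b
      simp only [Finset.mem_inter, mem_nbh, Finset.mem_biUnion, Finset.mem_filter]
      grind)
  obtain ⟨f, hf, hfm⟩ := hall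
  simp only [Finset.mem_filter] at hfm
  refine ⟨V, ?_, fun b => ⟨fun h => by simp [hpV b, h], fun h => by simp [hpV b, h]⟩⟩
  simp only [fam, Finset.mem_filter, Finset.mem_univ, true_and]
  refine ⟨hcard, f, hf, fun a => (hfm a).2, ?_⟩
  apply Finset.eq_of_subset_of_card_le
  · intro b hb
    simp only [Finset.mem_image, Finset.mem_univ, true_and] at hb
    obtain ⟨a, rfl⟩ := hb
    exact (hfm a).1
  · rw [Finset.card_image_of_injective _ hf, Finset.card_univ, hcard]

theorem sum_ge {α β : Type*} [Fintype α] [Fintype β] (E : α → β → Prop)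
    (u v : Finset β → β → ℝ) (huv : ∀ V b x, 0 ≤ x → x ≤ 1 → 0 ≤ u V b + v V b * x)
    (hv : ∀ V a b, 0 ≤ v V a * v V b)
    (h1 : ∀ V b, b ∈ V → u V b + v V b * 1 = 1) (h2 : ∀ V b, b ∉ V → u V b + v V b * 0 = 1)
    (p : β → ℝ) (hp : Feas E p) :
    1 ≤ ∑ V ∈ fam E, ∏ b, (u V b + v V b * p b) := by
  classical
  refine pipage E (fun p => ∑ V ∈ fam E, ∏ b, (u V b + v V b * p b)) ?_ ?_ p hp
  · intro p hp hI
    obtain ⟨V, hV, hVp⟩ := int_mem E p hp hI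
    have e : ∏ b, (u V b + v V b * p b) = 1 := by
      apply Finset.prod_eq_one
      intro b _
      by_cases hb : b ∈ V
      · rw [(hVp b).1 hb, h1 V b hb]
      · rw [(hVp b).2 hb, h2 V b hb]
    calc (1 : ℝ) = ∏ b, (u V b + v V b * p b) := e.symm
      _ ≤ _ := Finset.single_le_sum (f := fun V => ∏ b, (u V b + v V b * p b)) (fun W _ =>
          Finset.prod_nonneg fun b _ => by
            apply huv <;> rcases hI b with h | h <;> simp [h]) hV
  · intro p i j hij hp s t hs ht
    simp only [Finset.mul_sum, ← Finset.sum_add_distrib]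
    exact Finset.sum_le_sum fun V _ =>
      prod_conc (u V) (v V) (huv V) (hv V) p i j hij hp s t hs ht

theorem fam_bound {α β : Type*} [Fintype α] [Fintype β] (E : α → β → Prop) (x : ℝ)
    (hx0 : 0 ≤ x) (hx1 : x ≤ 1) (hp : Feas E (fun _ => x)) :
    1 ≤ ((fam E).card : ℝ) * x ^ Fintype.card α ∧
    1 ≤ ((fam E).card : ℝ) * (1 - x) ^ (Fintype.card β - Fintype.card α) := by
  classical
  have hc : ∀ V ∈ fam E, V.card = Fintype.card α := by
    intro V hV
    simp only [fam, Finset.mem_filter] at hV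
    exact hV.2.1
  constructor
  · have h := sum_ge E (fun V b => if b ∈ V then 0 else 1) (fun V b => if b ∈ V then 1 else 0)
      (by intros; split_ifs <;> simp_all) (by intros; split_ifs <;> simp)
      (by intro V b h; simp [h]) (by intro V b h; simp [h]) _ hp
    rw [Finset.sum_congr rfl (g := fun _ => x ^ Fintype.card α)] at h
    · simpa using h
    · intro V hV
      rw [← hc V hV, ← Finset.prod_const, ← Finset.prod_subset (Finset.subset_univ V)]
      · exact Finset.prod_congr rfl fun b hb => by simp [hb]
      · intro b _ hb; simp [hb]
  · have h := sum_ge E (fun V b => 1) (fun V b => if b ∈ V then 0 else -1)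
      (by intros; split_ifs <;> simp_all) (by intros; split_ifs <;> simp)
      (by intro V b h; simp [h]) (by intro V b h; simp) _ hp
    rw [Finset.sum_congr rfl (g := fun _ => (1 - x) ^ (Fintype.card β - Fintype.card α))] at h
    · simpa using h
    · intro V hV
      rw [← hc V hV, ← Finset.card_compl, ← Finset.prod_const,
        ← Finset.prod_subset (Finset.subset_univ Vᶜ)]
      · refine Finset.prod_congr rfl fun b hb => ?_
        rw [Finset.mem_compl] at hb
        simp [hb]; ring
      · intro b _ hb
        rw [Finset.mem_compl, not_not] at hb
        simp [hb]

end Helpers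

/-- In a normalized matching bipartite graph with parts of sizes `k ≤ n`,
the number of `k`-element subsets of the large side onto which there is a complete
matching is at least `√(C(n,k))`; in particular there are at least `√(C(n,k))`
complete matchings. -/
theorem stmt_1 {α β : Type*} [Fintype α] [Fintype β] [DecidableEq β]
    (E : α → β → Prop) [∀ i j, Decidable (E i j)] (k n : ℕ)
    (hk : Fintype.card α = k) (hn : Fintype.card β = n) (hkn : k ≤ n)
    (hnm : ∀ X : Finset α,
      X.card * n ≤ (Finset.univ.filter (fun j => ∃ i ∈ X, E i j)).card * k) :
    Real.sqrt (n.choose k) ≤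
      (Nat.card {V : Finset β // V.card = k ∧ ∃ f : α → β, Function.Injective f ∧
        (∀ i, E i (f i)) ∧ Finset.univ.image f = V} : ℝ) ∧
    Real.sqrt (n.choose k) ≤
      (Nat.card {f : α → β // Function.Injective f ∧ ∀ i, E i (f i)} : ℝ) := by
  classical
  subst hk hn
  set k := Fintype.card α with hk
  set n := Fintype.card β with hn
  have hnb : ∀ X : Finset α, (nbh E X) = Finset.univ.filter (fun j => ∃ i ∈ X, E i j) := by
    intro X; ext b; simp [mem_nbh]
  have hx0 : (0 : ℝ) ≤ (k : ℝ) / n := by positivity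
  have hkn' : (k : ℝ) ≤ n := by exact_mod_cast hkn
  have hx1 : (k : ℝ) / n ≤ 1 := div_le_one_of_le₀ hkn' (by positivity)
  have hnx : (n : ℝ) * ((k : ℝ) / n) = k := by
    rcases Nat.eq_zero_or_pos n with h | h
    · have : k = 0 := by omega
      simp [h, this]
    · have : (n : ℝ) ≠ 0 := by positivity
      field_simp
  have hp : Feas E (fun _ => (k : ℝ) / n) := by
    refine ⟨?_, ?_⟩
    · rintro (b | b | X)
      · simpa [cst, lin] using hx0
      · simpa [cst, lin] using hx1
      · have h := hnm X
        rw [← hnb] at h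
        have h' : (X.card : ℝ) * n ≤ (nbh E X).card * k := by exact_mod_cast h
        simp only [cst, lin, Finset.sum_const, nsmul_eq_mul]
        rcases Nat.eq_zero_or_pos n with hn0 | hn0
        · have hk0 : Fintype.card α = 0 := by omega
          have hX : X.card = 0 := by
            have := Finset.card_le_univ X
            omega
          rw [hX]; simp; positivity
        · have hn1 : (0 : ℝ) < n := by positivity
          have : (X.card : ℝ) ≤ (nbh E X).card * ((k : ℝ) / n) := by
            rw [← mul_div_assoc, le_div_iff₀ hn1]; exact h'
          linarith
    · simp only [Finset.sum_const, nsmul_eq_mul, Finset.card_univ]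
      exact hnx
  obtain ⟨b1, b2⟩ := fam_bound E _ hx0 hx1 hp
  rw [← hk] at b1 b2
  rw [← hn] at b2
  have hbin : (n.choose k : ℝ) * (((k : ℝ) / n) ^ k * (1 - (k : ℝ) / n) ^ (n - k)) ≤ 1 := by
    have h := add_pow ((k : ℝ) / n) (1 - (k : ℝ) / n) n
    have h1 : (k : ℝ) / n + (1 - (k : ℝ) / n) = 1 := by ring
    rw [h1, one_pow] at h
    have := Finset.single_le_sum (s := Finset.range (n + 1)) (f := fun m =>
      ((k : ℝ) / n) ^ m * (1 - (k : ℝ) / n) ^ (n - m) * (n.choose m : ℝ))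
      (fun m _ => by have : 0 ≤ 1 - (k : ℝ) / n := by linarith
                     positivity) (Finset.mem_range.2 (Nat.lt_succ_of_le hkn))
    rw [mul_comm]
    exact this.trans h.symm.le
  have hmain : Real.sqrt (n.choose k) ≤ ((fam E).card : ℝ) := by
    apply Real.sqrt_le_iff.2 ⟨by positivity, ?_⟩
    set y := ((k : ℝ) / n) ^ k
    set z := (1 - (k : ℝ) / n) ^ (n - k)
    set N := ((fam E).card : ℝ)
    have hN : 0 ≤ N := by positivity
    have hy : 0 < y := by
      by_contra h
      push Not at h
      nlinarith
    have hz : 0 < z := by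
      by_contra h
      push Not at h
      nlinarith
    have h1 : 1 ≤ (N * y) * (N * z) := by nlinarith
    have h2 : (n.choose k : ℝ) * (y * z) ≤ N ^ 2 * (y * z) := by nlinarith
    exact le_of_mul_le_mul_right h2 (mul_pos hy hz)
  have hfam : Nat.card {V : Finset β // V.card = k ∧ ∃ f : α → β, Function.Injective f ∧
        (∀ i, E i (f i)) ∧ Finset.univ.image f = V} = (fam E).card := by
    rw [← Nat.card_eq_finsetCard]
    refine Nat.card_congr (Equiv.subtypeEquivRight fun V => ?_)
    simp only [fam, Finset.mem_filter, Finset.mem_univ, true_and]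
    constructor
    · rintro ⟨h, f, h1, h2, h3⟩
      exact ⟨h, f, h1, h2, by rw [← h3]; ext b; simp⟩
    · rintro ⟨h, f, h1, h2, h3⟩
      exact ⟨h, f, h1, h2, by rw [← h3]; ext b; simp⟩
  refine ⟨by rw [hfam]; exact hmain, hmain.trans ?_⟩
  rw [← hfam]
  norm_cast
  refine Nat.card_le_card_of_surjective (fun f => ⟨Finset.univ.image f.1, ?_, f.1, f.2.1, f.2.2, rfl⟩) ?_
  · rw [Finset.card_image_of_injective _ f.2.1, Finset.card_univ]
  · rintro ⟨V, hV, f, hf, hE, rfl⟩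
    exact ⟨⟨f, hf, hE⟩, rfl⟩
end

section
/- The Boolean lattice 2^[n] has at least 2^(c·2^n·log n/√n) distinct partitions into C(n, ⌊n/2⌋) symmetric chains, for some absolute constant c > 0 and all sufficiently large n. -/
/-- A symmetric chain in `2^[n]`: a chain `c₀ ⊂ ... ⊂ c_k` with `|c_i| = (n-k)/2 + i`,
i.e. a chain whose set of cardinalities is an interval `[m, n-m]`. -/
def IsSymmetricChain (n : ℕ) (C : Finset (Finset (Fin n))) : Prop :=
  (∀ x ∈ C, ∀ y ∈ C, x ⊆ y ∨ y ⊆ x) ∧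
  ∃ m : ℕ, 2 * m ≤ n ∧ C.image Finset.card = Finset.Icc m (n - m)

/-- A symmetric chain decomposition of `2^[n]`. -/
def IsSymmetricChainDecomposition (n : ℕ) (P : Finset (Finset (Finset (Fin n)))) : Prop :=
  (∀ C ∈ P, IsSymmetricChain n C) ∧ ∀ x : Finset (Fin n), ∃! C, C ∈ P ∧ x ∈ C

/-! ### Symmetric chain decompositions of a rectangle -/

/-- labels present at rank `r` of the `(P+1) × (Q+1)` rectangle -/
def rectLabels (P Q r : ℕ) : Finset ℕ :=
  (Finset.range (min P Q + 1)).filter (fun j => j ≤ r ∧ j + r ≤ P + Q)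

/-- relative position of label `i` at rank `r` -/
def rectPos (key : ℕ → ℕ) (P Q r i : ℕ) : ℕ :=
  ((rectLabels P Q r).filter (fun j => key j < key i)).card

/-- first coordinate of the element of rank `r` in the chain with label `i` -/
def rectX (key : ℕ → ℕ) (P Q r i : ℕ) : ℕ := (r - Q) + rectPos key P Q r i

lemma mem_rectLabels {P Q r j : ℕ} :
    j ∈ rectLabels P Q r ↔ j ≤ P ∧ j ≤ Q ∧ j ≤ r ∧ j + r ≤ P + Q := by
  simp only [rectLabels, Finset.mem_filter, Finset.mem_range]
  omega

lemma card_rectLabels {P Q r : ℕ} (h : r ≤ P + Q) :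
    (rectLabels P Q r).card = min (min P Q) (min r (P + Q - r)) + 1 := by
  have : rectLabels P Q r = Finset.range (min (min P Q) (min r (P + Q - r)) + 1) := by
    ext j
    rw [mem_rectLabels, Finset.mem_range]
    omega
  rw [this, Finset.card_range]

lemma rectPos_lt {key : ℕ → ℕ} {P Q r i : ℕ} (hi : i ∈ rectLabels P Q r) :
    rectPos key P Q r i < (rectLabels P Q r).card := by
  apply Finset.card_lt_card
  rw [Finset.filter_ssubset]
  exact ⟨i, hi, by simp⟩

lemma rectX_bounds {key : ℕ → ℕ} {P Q r i : ℕ} (hi : i ∈ rectLabels P Q r) :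
    rectX key P Q r i ≤ P ∧ rectX key P Q r i ≤ r ∧ r - rectX key P Q r i ≤ Q := by
  have h := rectPos_lt (key := key) hi
  have hi' := mem_rectLabels.1 hi
  rw [card_rectLabels (by omega)] at h
  unfold rectX
  omega

lemma rectX_step {key : ℕ → ℕ} {P Q r i : ℕ} :
    rectX key P Q r i ≤ rectX key P Q (r + 1) i ∧
      rectX key P Q (r + 1) i ≤ rectX key P Q r i + 1 := by
  unfold rectX rectPos
  rcases lt_or_ge r Q with h | h
  · have h1 : (rectLabels P Q r).filter (fun j => key j < key i) ⊆
        (rectLabels P Q (r+1)).filter (fun j => key j < key i) := by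
      intro j
      simp only [Finset.mem_filter, mem_rectLabels]
      omega
    have h2 : (rectLabels P Q (r+1)).filter (fun j => key j < key i) ⊆
        insert (r+1) ((rectLabels P Q r).filter (fun j => key j < key i)) := by
      intro j
      simp only [Finset.mem_filter, mem_rectLabels, Finset.mem_insert]
      omega
    have h3 := Finset.card_le_card h1
    have h4 := (Finset.card_le_card h2).trans (Finset.card_insert_le _ _)
    omega
  · have h1 : (rectLabels P Q (r+1)).filter (fun j => key j < key i) ⊆
        (rectLabels P Q r).filter (fun j => key j < key i) := by
      intro j
      simp only [Finset.mem_filter, mem_rectLabels]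
      omega
    have h2 : (rectLabels P Q r).filter (fun j => key j < key i) ⊆
        insert (P+Q-r) ((rectLabels P Q (r+1)).filter (fun j => key j < key i)) := by
      intro j
      simp only [Finset.mem_filter, mem_rectLabels, Finset.mem_insert]
      omega
    have h3 := Finset.card_le_card h1
    have h4 := (Finset.card_le_card h2).trans (Finset.card_insert_le _ _)
    omega

lemma rectX_mono {key : ℕ → ℕ} {P Q i r r' : ℕ} (h : r ≤ r') :
    rectX key P Q r i ≤ rectX key P Q r' i ∧
      rectX key P Q r' i + r ≤ rectX key P Q r i + r' := by
  induction r', h using Nat.le_induction with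
  | base => simp
  | succ r' hr ih =>
    have := rectX_step (key := key) (P := P) (Q := Q) (r := r') (i := i)
    omega

lemma rectPos_injOn {key : ℕ → ℕ} {P Q r : ℕ}
    (hk : ∀ i ≤ min P Q, ∀ j ≤ min P Q, key i = key j → i = j) :
    Set.InjOn (rectPos key P Q r) (rectLabels P Q r : Set ℕ) := by
  have key_lt : ∀ i ∈ rectLabels P Q r, ∀ j, key i < key j →
      rectPos key P Q r i < rectPos key P Q r j := by
    intro i hi j hij
    apply Finset.card_lt_card
    rw [Finset.ssubset_iff_of_subset]
    · exact ⟨i, by simp [hi, hij], by simp⟩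
    · intro x
      simp only [Finset.mem_filter]
      rintro ⟨h1, h2⟩
      exact ⟨h1, h2.trans hij⟩
  intro i hi j hj hij
  have hi := Finset.mem_coe.1 hi
  have hj := Finset.mem_coe.1 hj
  have hi' := mem_rectLabels.1 hi
  have hj' := mem_rectLabels.1 hj
  apply hk i (by omega) j (by omega)
  rcases lt_trichotomy (key i) (key j) with h | h | h
  · have := key_lt i hi j h
    omega
  · exact h
  · have := key_lt j hj i h
    omega

lemma rect_exists {key : ℕ → ℕ} {P Q : ℕ}
    (hk : ∀ i ≤ min P Q, ∀ j ≤ min P Q, key i = key j → i = j)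
    {x y : ℕ} (hx : x ≤ P) (hy : y ≤ Q) :
    ∃ i ∈ rectLabels P Q (x + y), rectX key P Q (x + y) i = x := by
  have hc := card_rectLabels (P := P) (Q := Q) (r := x + y) (by omega)
  have him : (rectLabels P Q (x+y)).image (rectPos key P Q (x+y)) =
      Finset.range (rectLabels P Q (x+y)).card := by
    apply Finset.eq_of_subset_of_card_le
    · intro z hz
      obtain ⟨i, hi, rfl⟩ := Finset.mem_image.1 hz
      exact Finset.mem_range.2 (rectPos_lt hi)
    · rw [Finset.card_image_of_injOn (rectPos_injOn hk), Finset.card_range]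
  have hm : x - (x + y - Q) ∈ Finset.range (rectLabels P Q (x+y)).card := by
    rw [Finset.mem_range, hc]
    omega
  rw [← him] at hm
  obtain ⟨i, hi, h⟩ := Finset.mem_image.1 hm
  refine ⟨i, hi, ?_⟩
  unfold rectX
  omega

lemma rect_recover (k : ℕ) (σ : Equiv.Perm (Fin (k+1))) (key : ℕ → ℕ)
    (hkey : ∀ i : Fin (k+1), key i = σ i) {P Q : ℕ} (hPQ : k = min P Q) (i : Fin (k+1)) :
    rectX key P Q k i = σ i := by
  have h0 : k - Q = 0 := by omega
  unfold rectX rectPos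
  rw [h0, zero_add]
  have : (rectLabels P Q k).filter (fun j => key j < key i) =
      ((Finset.univ : Finset (Fin (k+1))).filter (fun j => σ j < σ i)).map Fin.valEmbedding := by
    ext j
    simp only [Finset.mem_filter, mem_rectLabels, Finset.mem_map, Finset.mem_univ, true_and,
      Fin.valEmbedding_apply]
    constructor
    · rintro ⟨h1, h2⟩
      refine ⟨⟨j, by omega⟩, ?_, rfl⟩
      rw [hkey i] at h2
      have := hkey ⟨j, by omega⟩
      simp only at this
      rw [this] at h2
      exact h2
    · rintro ⟨j, h, rfl⟩
      refine ⟨by omega, ?_⟩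
      rw [hkey, hkey]
      exact h
  rw [this, Finset.card_map]
  have h2 : ((Finset.univ : Finset (Fin (k+1))).filter (fun j => σ j < σ i)) =
      (Finset.Iio (σ i)).map σ.symm.toEmbedding := by
    ext j
    simp only [Finset.mem_filter, Finset.mem_univ, true_and, Finset.mem_map_equiv,
      Equiv.symm_symm, Finset.mem_Iio]
  rw [h2, Finset.card_map, Fin.card_Iio]
/-! ### Indexed symmetric chain decompositions -/

/-- An indexed symmetric chain decomposition of the subsets of `α`. -/
structure SCDData (α : Type) [Fintype α] where
  ι : Type
  fin : Fintype ι
  m : ι → ℕ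
  len : ι → ℕ
  c : ι → ℕ → Finset α
  hlen : ∀ i, 2 * m i + len i = Fintype.card α
  hcard : ∀ i k, k ≤ len i → (c i k).card = m i + k
  hmono : ∀ i k k', k ≤ k' → k' ≤ len i → c i k ⊆ c i k'
  hex : ∀ x, ∃ i k, k ≤ len i ∧ c i k = x
  huniq : ∀ i j k k', k ≤ len i → k' ≤ len j → c i k = c j k' → i = j

attribute [instance] SCDData.fin

namespace SCDData

open Classical in
/-- The number of chains meeting level `h`. -/
lemma card_long {α : Type} [Fintype α] (A : SCDData α) (h : ℕ) (hh : 2 * h ≤ Fintype.card α) :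
    ((Finset.univ : Finset A.ι).filter (fun i => A.m i ≤ h)).card = (Fintype.card α).choose h := by
  rw [← Finset.card_univ (α := α), ← Finset.card_powersetCard]
  apply Finset.card_bij (fun i _ => A.c i (h - A.m i))
  · intro i hi
    have hi := (Finset.mem_filter.1 hi).2
    have h1 := A.hlen i
    rw [Finset.mem_powersetCard]
    refine ⟨Finset.subset_univ _, ?_⟩
    rw [A.hcard _ _ (by omega)]
    omega
  · intro i hi j hj hij
    have hi := (Finset.mem_filter.1 hi).2
    have hj := (Finset.mem_filter.1 hj).2
    have h1 := A.hlen i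
    have h2 := A.hlen j
    exact A.huniq _ _ _ _ (by omega) (by omega) hij
  · intro x hx
    have hx := (Finset.mem_powersetCard.1 hx).2
    obtain ⟨i, k, hk, rfl⟩ := A.hex x
    rw [A.hcard _ _ hk] at hx
    refine ⟨i, by simp; omega, ?_⟩
    congr 1
    omega

lemma card_index {α : Type} [Fintype α] (A : SCDData α) :
    Fintype.card A.ι = (Fintype.card α).choose (Fintype.card α / 2) := by
  classical
  rw [← A.card_long _ (by omega), Finset.filter_true_of_mem, Finset.card_univ]
  intro i _
  have := A.hlen i
  omega

lemma sum_len {α : Type} [Fintype α] (A : SCDData α) :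
    ∑ i, (A.len i + 1) = 2 ^ Fintype.card α := by
  classical
  rw [← Fintype.card_finset]
  have : Fintype.card (Σ i : A.ι, Fin (A.len i + 1)) = Fintype.card (Finset α) := by
    apply Fintype.card_of_bijective (f := fun p => A.c p.1 p.2)
    constructor
    · rintro ⟨i, k⟩ ⟨j, l⟩ h
      simp only at h
      obtain rfl := A.huniq _ _ _ _ (by omega) (by omega) h
      have := congrArg Finset.card h
      rw [A.hcard _ _ (by omega), A.hcard _ _ (by omega)] at this
      congr 1
      ext
      omega
    · intro x
      obtain ⟨i, k, hk, h⟩ := A.hex x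
      exact ⟨⟨i, ⟨k, by omega⟩⟩, h⟩
  rw [← this]
  simp

/-- Transport along an equivalence. -/
def map {α β : Type} [Fintype α] [Fintype β] (A : SCDData α) (e : α ≃ β) : SCDData β where
  ι := A.ι
  fin := A.fin
  m := A.m
  len := A.len
  c i k := (A.c i k).map e.toEmbedding
  hlen i := by rw [A.hlen i, Fintype.card_congr e]
  hcard i k h := by rw [Finset.card_map, A.hcard i k h]
  hmono i k k' h h' := Finset.map_subset_map.2 (A.hmono i k k' h h')
  hex x := by
    obtain ⟨i, k, h, h'⟩ := A.hex (x.map e.symm.toEmbedding)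
    refine ⟨i, k, h, ?_⟩
    rw [h']
    ext
    simp
  huniq i j k k' h h' hh := A.huniq i j k k' h h' (Finset.map_injective _ hh)

/-- The key function of a permutation. -/
def keyOf {k : ℕ} (σ : Equiv.Perm (Fin (k+1))) (i : ℕ) : ℕ :=
  if h : i < k + 1 then σ ⟨i, h⟩ else 0

lemma keyOf_val {k : ℕ} (σ : Equiv.Perm (Fin (k+1))) (i : Fin (k+1)) : keyOf σ i = σ i := by
  simp only [keyOf, i.2, dif_pos]

lemma keyOf_inj {k : ℕ} (σ : Equiv.Perm (Fin (k+1))) :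
    ∀ i ≤ k, ∀ j ≤ k, keyOf σ i = keyOf σ j → i = j := by
  intro i hi j hj h
  have h1 := keyOf_val σ ⟨i, by omega⟩
  have h2 := keyOf_val σ ⟨j, by omega⟩
  simp only at h1 h2
  rw [h1, h2] at h
  have := σ.injective (Fin.ext h)
  simpa using this

/-- The choices in the product construction. -/
abbrev Choice {α β : Type} [Fintype α] [Fintype β] (A : SCDData α) (B : SCDData β) : Type :=
  (p : A.ι × B.ι) → Equiv.Perm (Fin (min (A.len p.1) (B.len p.2) + 1))

/-- first coordinate of an element in the product construction. -/
abbrev px {α β : Type} [Fintype α] [Fintype β] (A : SCDData α) (B : SCDData β)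
    (ω : Choice A B) (p : A.ι × B.ι) (r l : ℕ) : ℕ :=
  rectX (keyOf (ω p)) (A.len p.1) (B.len p.2) r l

lemma disjSum_inj {α β : Type} {s s' : Finset α} {t t' : Finset β}
    (h : s.disjSum t = s'.disjSum t') : s = s' ∧ t = t' := by
  have h1 := congrArg Finset.toLeft h
  have h2 := congrArg Finset.toRight h
  simpa using And.intro h1 h2

lemma px_bounds {α β : Type} [Fintype α] [Fintype β] (A : SCDData α) (B : SCDData β)
    (ω : Choice A B) (p : A.ι × B.ι) (l : Fin (min (A.len p.1) (B.len p.2) + 1)) (k : ℕ)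
    (hk : k ≤ A.len p.1 + B.len p.2 - 2 * l) :
    px A B ω p (l + k) l ≤ A.len p.1 ∧ px A B ω p (l + k) l ≤ l + k ∧
      l + k - px A B ω p (l + k) l ≤ B.len p.2 := by
  apply rectX_bounds
  rw [mem_rectLabels]
  omega

/-- The product construction. -/
def prod {α β : Type} [Fintype α] [Fintype β] (A : SCDData α) (B : SCDData β)
    (ω : Choice A B) : SCDData (α ⊕ β) where
  ι := Σ p : A.ι × B.ι, Fin (min (A.len p.1) (B.len p.2) + 1)
  fin := inferInstance
  m q := A.m q.1.1 + B.m q.1.2 + q.2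
  len q := A.len q.1.1 + B.len q.1.2 - 2 * q.2
  c q k := (A.c q.1.1 (px A B ω q.1 (q.2 + k) q.2)).disjSum
    (B.c q.1.2 (q.2 + k - px A B ω q.1 (q.2 + k) q.2))
  hlen q := by
    have h1 := A.hlen q.1.1
    have h2 := B.hlen q.1.2
    have h3 := q.2.2
    rw [Fintype.card_sum]
    omega
  hcard q k h := by
    have hb := px_bounds A B ω q.1 q.2 k h
    rw [Finset.card_disjSum, A.hcard _ _ hb.1, B.hcard _ _ hb.2.2]
    omega
  hmono q k k' h h' := by
    have hb := px_bounds A B ω q.1 q.2 k (h.trans h')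
    have hb' := px_bounds A B ω q.1 q.2 k' h'
    have hm := rectX_mono (key := keyOf (ω q.1)) (P := A.len q.1.1) (Q := B.len q.1.2)
      (i := q.2) (r := q.2 + k) (r' := q.2 + k') (by omega)
    apply Finset.disjSum_mono
    · exact A.hmono _ _ _ hm.1 hb'.1
    · apply B.hmono _ _ _ _ hb'.2.2
      unfold px
      omega
  hex x := by
    obtain ⟨i, x1, h1, h1'⟩ := A.hex x.toLeft
    obtain ⟨j, y1, h2, h2'⟩ := B.hex x.toRight
    obtain ⟨l, hl, hX⟩ := rect_exists (keyOf_inj (ω (i,j))) h1 h2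
    have hl' := mem_rectLabels.1 hl
    simp only at hl'
    refine ⟨⟨(i, j), ⟨l, by simp only; omega⟩⟩, x1 + y1 - l, by simp only; omega, ?_⟩
    have e : l + (x1 + y1 - l) = x1 + y1 := by omega
    simp only [px]
    rw [e, hX, h1', Nat.add_sub_cancel_left, h2', Finset.toLeft_disjSum_toRight]
  huniq := by
    rintro ⟨⟨i, j⟩, l⟩ ⟨⟨i', j'⟩, l'⟩ k k' hk hk' h
    have hb := px_bounds A B ω (i, j) l k hk
    have hb' := px_bounds A B ω (i', j') l' k' hk'
    obtain ⟨e1, e2⟩ := disjSum_inj h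
    obtain rfl := A.huniq _ _ _ _ hb.1 hb'.1 e1
    obtain rfl := B.huniq _ _ _ _ hb.2.2 hb'.2.2 e2
    have c1 := congrArg Finset.card e1
    have c2 := congrArg Finset.card e2
    rw [A.hcard _ _ hb.1, A.hcard _ _ hb'.1] at c1
    rw [B.hcard _ _ hb.2.2, B.hcard _ _ hb'.2.2] at c2
    simp only at c1 c2 hb hb' hk hk'
    have er : (l : ℕ) + k = l' + k' := by omega
    have c3 : px A B ω (i, j) (l + k) l = px A B ω (i, j) (l + k) l' := by
      rw [← er] at c1
      omega
    have c4 : rectPos (keyOf (ω (i,j))) (A.len i) (B.len j) (l + k) l =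
      rectPos (keyOf (ω (i,j))) (A.len i) (B.len j) (l + k) l' := by
      simp only [px, rectX] at c3
      omega
    have hl := l.2
    have hl' := l'.2
    simp only at hl hl'
    have := rectPos_injOn (keyOf_inj (ω (i,j)))
      (Finset.mem_coe.2 (mem_rectLabels.2 (by simp only; omega)))
      (Finset.mem_coe.2 (mem_rectLabels.2 (by simp only; omega))) c4
    have : l = l' := Fin.ext this
    rw [this]

lemma exists_fin (n : ℕ) : Nonempty (SCDData (Fin n)) := by
  induction n with
  | zero =>
    exact ⟨{ ι := Unit
             fin := inferInstance
             m := fun _ => 0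
             len := fun _ => 0
             c := fun _ _ => ∅
             hlen := by simp
             hcard := by intro i k h; simp at h ⊢; omega
             hmono := by simp
             hex := fun x => ⟨(), 0, le_rfl, by ext a; exact a.elim0⟩
             huniq := by simp }⟩
  | succ n ih =>
    obtain ⟨A⟩ := ih
    let B : SCDData (Fin 1) :=
           { ι := Unit
             fin := inferInstance
             m := fun _ => 0
             len := fun _ => 1
             c := fun _ k => if k = 0 then ∅ else Finset.univ
             hlen := by simp
             hcard := by
              intro i k h
              interval_cases k <;> simp
             hmono := by
              intro i k k' h h'
              by_cases hk : k = 0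
              · simp [hk]
              · simp [hk, show k' ≠ 0 by omega]
             hex := fun x => by
              rcases Finset.eq_empty_or_nonempty x with h | ⟨a, ha⟩
              · exact ⟨(), 0, by simp, by simp [h]⟩
              · refine ⟨(), 1, by simp, ?_⟩
                ext b
                simp only [one_ne_zero, if_false, Finset.mem_univ, true_iff]
                rwa [Subsingleton.elim b a]
             huniq := by simp }
    exact ⟨(A.prod B (fun _ => 1)).map finSumFinEquiv⟩

open Classical in
/-- The underlying set of a chain. -/
noncomputable def chain {α : Type} [Fintype α] (A : SCDData α) (i : A.ι) : Finset (Finset α) :=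
  (Finset.range (A.len i + 1)).image (A.c i)

open Classical in
/-- The underlying partition. -/
noncomputable def parts {α : Type} [Fintype α] (A : SCDData α) : Finset (Finset (Finset α)) :=
  Finset.univ.image A.chain

lemma mem_chain {α : Type} [Fintype α] (A : SCDData α) (i : A.ι) (x : Finset α) :
    x ∈ A.chain i ↔ ∃ k ≤ A.len i, A.c i k = x := by
  simp [chain]

lemma mem_parts {α : Type} [Fintype α] (A : SCDData α) (C : Finset (Finset α)) :
    C ∈ A.parts ↔ ∃ i, A.chain i = C := by
  simp [parts]

lemma chain_injective {α : Type} [Fintype α] (A : SCDData α) : Function.Injective A.chain := by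
  intro i j h
  have h1 : A.c i 0 ∈ A.chain i := (A.mem_chain _ _).2 ⟨0, by omega, rfl⟩
  rw [h, mem_chain] at h1
  obtain ⟨k, hk, e⟩ := h1
  exact (A.huniq _ _ _ _ hk (by omega) e).symm

lemma card_parts {α : Type} [Fintype α] (A : SCDData α) :
    A.parts.card = (Fintype.card α).choose (Fintype.card α / 2) := by
  classical
  rw [parts, Finset.card_image_of_injective _ A.chain_injective, Finset.card_univ, A.card_index]

lemma isSCD {n : ℕ} (A : SCDData (Fin n)) : IsSymmetricChainDecomposition n A.parts := by
  constructor
  · intro C hC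
    obtain ⟨i, rfl⟩ := (A.mem_parts _).1 hC
    have hl := A.hlen i
    rw [Fintype.card_fin] at hl
    refine ⟨?_, A.m i, by omega, ?_⟩
    · intro x hx y hy
      obtain ⟨k, hk, rfl⟩ := (A.mem_chain _ _).1 hx
      obtain ⟨k', hk', rfl⟩ := (A.mem_chain _ _).1 hy
      rcases le_total k k' with h | h
      · exact Or.inl (A.hmono _ _ _ h hk')
      · exact Or.inr (A.hmono _ _ _ h hk)
    · ext j
      simp only [Finset.mem_image, mem_chain, Finset.mem_Icc]
      constructor
      · rintro ⟨x, ⟨k, hk, rfl⟩, rfl⟩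
        rw [A.hcard _ _ hk]
        omega
      · rintro ⟨h1, h2⟩
        refine ⟨_, ⟨j - A.m i, by omega, rfl⟩, ?_⟩
        rw [A.hcard _ _ (by omega)]
        omega
  · intro x
    obtain ⟨i, k, hk, rfl⟩ := A.hex x
    refine ⟨A.chain i, ⟨(A.mem_parts _).2 ⟨i, rfl⟩, (A.mem_chain _ _).2 ⟨k, hk, rfl⟩⟩, ?_⟩
    rintro C ⟨h1, h2⟩
    obtain ⟨j, rfl⟩ := (A.mem_parts _).1 h1
    obtain ⟨k', hk', e⟩ := (A.mem_chain _ _).1 h2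
    rw [A.huniq _ _ _ _ hk' hk e]

lemma chain_eq {α : Type} [Fintype α] {A B : SCDData α} {i : A.ι} {j : B.ι}
    (h : A.chain i = B.chain j) :
    A.m i = B.m j ∧ A.len i = B.len j ∧ ∀ k ≤ A.len i, A.c i k = B.c j k := by
  have hi := A.hlen i
  have hj := B.hlen j
  have h1 : A.c i 0 ∈ A.chain i := (A.mem_chain _ _).2 ⟨0, by omega, rfl⟩
  have h2 : B.c j 0 ∈ B.chain j := (B.mem_chain _ _).2 ⟨0, by omega, rfl⟩
  rw [h, mem_chain] at h1
  rw [← h, mem_chain] at h2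
  obtain ⟨k, hk, e⟩ := h1
  obtain ⟨k', hk', e'⟩ := h2
  have c1 := congrArg Finset.card e
  have c2 := congrArg Finset.card e'
  rw [A.hcard _ _ (by omega), B.hcard _ _ (by omega)] at c1 c2
  have hm : A.m i = B.m j := by omega
  refine ⟨hm, by omega, ?_⟩
  intro k hk
  have h3 : A.c i k ∈ A.chain i := (A.mem_chain _ _).2 ⟨k, hk, rfl⟩
  rw [h, mem_chain] at h3
  obtain ⟨l, hl, e⟩ := h3
  have c1 := congrArg Finset.card e
  rw [A.hcard _ _ (by omega), B.hcard _ _ (by omega)] at c1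
  rw [← e]
  congr 1
  omega

lemma parts_injective {α β γ : Type} [Fintype α] [Fintype β] [Fintype γ] (A : SCDData α)
    (B : SCDData β) (e : α ⊕ β ≃ γ) :
    Function.Injective (fun ω : Choice A B => ((A.prod B ω).map e).parts) := by
  intro ω ω' h
  simp only at h
  funext p
  obtain ⟨i, j⟩ := p
  ext l
  have hl := l.2
  simp only at hl
  have hm : ((A.prod B ω).map e).chain ⟨(i, j), l⟩ ∈ ((A.prod B ω).map e).parts :=
    (mem_parts _ _).2 ⟨_, rfl⟩
  rw [h, mem_parts] at hm
  obtain ⟨⟨⟨i', j'⟩, l'⟩, hc⟩ := hm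
  obtain ⟨h1, h2, h3⟩ := chain_eq hc.symm
  have hl' := l'.2
  simp only at hl'
  have hK : min (A.len i) (B.len j) - l ≤ A.len i + B.len j - 2 * l := by omega
  have h4 := h3 (min (A.len i) (B.len j) - l) hK
  have h5 := disjSum_inj (Finset.map_injective _ h4)
  change A.m i + B.m j + l = A.m i' + B.m j' + l' at h1
  change A.len i + B.len j - 2 * l = A.len i' + B.len j' - 2 * l' at h2
  obtain ⟨e1, e2⟩ := h5
  have hb := px_bounds A B ω (i, j) l _ hK
  have hb' := px_bounds A B ω' (i', j') l' _ (hK.trans h2.le)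
  obtain rfl := A.huniq _ _ _ _ hb.1 hb'.1 e1
  obtain rfl := B.huniq _ _ _ _ hb.2.2 hb'.2.2 e2
  have hll : l = l' := Fin.ext (by simp only at h1; omega)
  subst hll
  have c1 := congrArg Finset.card e1
  rw [A.hcard _ _ hb.1, A.hcard _ _ hb'.1] at c1
  have er : (l : ℕ) + (min (A.len i) (B.len j) - l) = min (A.len i) (B.len j) := by omega
  simp only [px] at c1
  rw [er, rect_recover _ (ω (i, j)) _ (keyOf_val _) rfl,
    rect_recover _ (ω' (i, j)) _ (keyOf_val _) rfl] at c1
  omega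

lemma count_ge {n a b : ℕ} (hn : a + b = n) (A : SCDData (Fin a)) (B : SCDData (Fin b)) :
    ∏ p : A.ι × B.ι, (min (A.len p.1) (B.len p.2) + 1).factorial ≤
      Nat.card {P : Finset (Finset (Finset (Fin n))) //
          IsSymmetricChainDecomposition n P ∧ P.card = n.choose (n / 2)} := by
  classical
  subst hn
  have h1 : Nat.card (Choice A B) =
      ∏ p : A.ι × B.ι, (min (A.len p.1) (B.len p.2) + 1).factorial := by
    rw [Nat.card_eq_fintype_card, Fintype.card_pi]
    simp [Fintype.card_perm]
  rw [← h1]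
  apply Nat.card_le_card_of_injective
    (fun ω : Choice A B => ⟨((A.prod B ω).map finSumFinEquiv).parts, isSCD _, by
      rw [card_parts, Fintype.card_fin]⟩)
  intro ω ω' h
  exact parts_injective A B _ (congrArg Subtype.val h)

end SCDData
/-! ### Estimates -/

lemma pow_le_factorial_mul (t p : ℕ) : t ^ p ≤ p.factorial * t ^ t := by
  rcases Nat.eq_zero_or_pos t with rfl | ht
  · rcases Nat.eq_zero_or_pos p with rfl | hp
    · simp
    · rw [zero_pow (by omega)]; omega
  rcases le_total p t with h | h
  · calc t ^ p ≤ t ^ t := Nat.pow_le_pow_right ht h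
      _ ≤ _ := Nat.le_mul_of_pos_left _ (Nat.factorial_pos _)
  · obtain ⟨k, rfl⟩ := Nat.exists_eq_add_of_le h
    have := Nat.factorial_mul_pow_le_factorial (m := t) (n := k)
    have h2 : t ^ k ≤ (t+k).factorial :=
      calc t ^ k ≤ (t+1) ^ k := Nat.pow_le_pow_left (by omega) _
        _ ≤ t.factorial * (t+1)^k := Nat.le_mul_of_pos_left _ (Nat.factorial_pos _)
        _ ≤ _ := this
    rw [pow_add, mul_comm]
    exact Nat.mul_le_mul_right _ h2

lemma centralBinom_upper (j : ℕ) : j.centralBinom ^ 2 * (2 * j + 1) ≤ 16 ^ j := by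
  induction j with
  | zero => simp
  | succ j ih =>
    have h := Nat.succ_mul_centralBinom_succ j
    have h2 : ((j+1).centralBinom ^ 2 * (2 * (j+1) + 1)) * (j+1)^2 ≤ 16 ^ (j+1) * (j+1)^2 := by
      calc ((j+1).centralBinom ^ 2 * (2 * (j+1) + 1)) * (j+1)^2
          = ((j+1) * (j+1).centralBinom)^2 * (2 * j + 3) := by ring
        _ = (j.centralBinom ^ 2 * (2 * j + 1)) * (4 * (2*j+1) * (2*j+3)) := by rw [h]; ring
        _ ≤ 16 ^ j * (16 * (j+1)^2) := by
          apply Nat.mul_le_mul ih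
          nlinarith
        _ = _ := by ring
    exact Nat.le_of_mul_le_mul_right h2 (by positivity)

lemma centralBinom_lower (j : ℕ) (hj : 1 ≤ j) : 16 ^ j ≤ j.centralBinom ^ 2 * (4 * j) := by
  induction j, hj using Nat.le_induction with
  | base => simp [Nat.centralBinom, Nat.choose]
  | succ j hj ih =>
    have h := Nat.succ_mul_centralBinom_succ j
    have h2 : 16 ^ (j+1) * (j * (j+1)^2) ≤ ((j+1).centralBinom ^ 2 * (4 * (j+1))) * (j * (j+1)^2) := by
      calc 16 ^ (j+1) * (j * (j+1)^2) = 16 ^ j * (16 * j * (j+1)^2) := by ring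
        _ ≤ (j.centralBinom ^ 2 * (4 * j)) * (4 * (2*j+1)^2 * (j+1)) := by
          apply Nat.mul_le_mul ih
          nlinarith
        _ = (2 * (2 * j + 1) * j.centralBinom)^2 * (4 * (j+1) * j) := by ring
        _ = _ := by rw [← h]; ring
    exact Nat.le_of_mul_le_mul_right h2 (by positivity)

lemma choose_shift (m i : ℕ) (hm : 1 ≤ m) :
    (m.centralBinom : ℝ) * 2 ^ i * (2 * m - i ^ 2) ≤ (2 * m + i).choose m * (2 * m) := by
  induction i with
  | zero => simp [Nat.centralBinom]
  | succ i ih =>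
    have h : ((2 * m + i + 1).choose m : ℝ) * (m + i + 1) = (2 * m + i).choose m * (2 * m + i + 1) := by
      have := Nat.choose_mul_succ_eq (2 * m + i) m
      rw [show 2 * m + i + 1 - m = m + i + 1 by omega] at this
      exact_mod_cast this.symm
    have hp : (0:ℝ) < m + i + 1 := by positivity
    have hC : (0:ℝ) ≤ (m.centralBinom : ℝ) * 2 ^ i := by positivity
    have key : ((2:ℝ) * m - (i+1)^2) * (2 * (m + i + 1)) ≤ (2 * m - i^2) * (2 * m + i + 1) := by
      have h1 : (0:ℝ) ≤ m := by positivity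
      have h2 : (0:ℝ) ≤ i := by positivity
      have h3 := mul_nonneg h1 h2
      have h4 := mul_nonneg h2 h2
      have h5 := mul_nonneg h4 h2
      nlinarith
    have : ((m.centralBinom : ℝ) * 2 ^ (i+1) * (2 * m - ((i+1 : ℕ):ℝ) ^ 2)) * (m + i + 1) ≤
        ((2 * m + i + 1).choose m * (2 * m)) * (m + i + 1) := by
      calc ((m.centralBinom : ℝ) * 2 ^ (i+1) * (2 * m - ((i+1 : ℕ):ℝ) ^ 2)) * (m + i + 1)
          = ((m.centralBinom : ℝ) * 2 ^ i) * ((2 * m - (i+1)^2) * (2 * (m + i + 1))) := by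
            push_cast; ring
        _ ≤ ((m.centralBinom : ℝ) * 2 ^ i) * ((2 * m - i^2) * (2 * m + i + 1)) :=
            mul_le_mul_of_nonneg_left key hC
        _ = ((m.centralBinom : ℝ) * 2 ^ i * (2 * m - i ^ 2)) * (2 * m + i + 1) := by ring
        _ ≤ ((2 * m + i).choose m * (2 * m)) * (2 * m + i + 1) :=
            mul_le_mul_of_nonneg_right ih (by positivity)
        _ = ((2 * m + i + 1).choose m * (m + i + 1)) * (2 * m) := by rw [h]; ring
        _ = _ := by ring
    exact le_of_mul_le_mul_right this hp

lemma choose_lower (m s : ℕ) (hm : 1 ≤ m) (hs : s ^ 2 ≤ m) :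
    (2:ℝ) ^ (2 * m + s) ≤ (2 * m + s).choose m * (4 * Real.sqrt m) := by
  have h1 := choose_shift m s hm
  have hm' : (0:ℝ) < m := by exact_mod_cast hm
  have hs' : (s:ℝ)^2 ≤ m := by exact_mod_cast hs
  have h2 : (m.centralBinom : ℝ) * 2 ^ s ≤ 2 * (2 * m + s).choose m := by
    have : ((m.centralBinom : ℝ) * 2 ^ s) * m ≤ (2 * (2 * m + s).choose m) * m := by
      calc ((m.centralBinom : ℝ) * 2 ^ s) * m ≤ (m.centralBinom : ℝ) * 2 ^ s * (2 * m - s ^ 2) :=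
            mul_le_mul_of_nonneg_left (by linarith) (by positivity)
        _ ≤ _ := h1
        _ = _ := by ring
    exact le_of_mul_le_mul_right this hm'
  have h3 : (4:ℝ) ^ m ≤ m.centralBinom * (2 * Real.sqrt m) := by
    apply le_of_sq_le_sq _ (by positivity)
    have := centralBinom_lower m hm
    have h4 : (16:ℝ) ^ m ≤ m.centralBinom ^ 2 * (4 * m) := by exact_mod_cast this
    calc ((4:ℝ)^m)^2 = 16 ^ m := by rw [← pow_mul, mul_comm, pow_mul]; norm_num
      _ ≤ _ := h4
      _ = _ := by rw [mul_pow, mul_pow, Real.sq_sqrt hm'.le]; ring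
  calc (2:ℝ) ^ (2 * m + s) = 4 ^ m * 2 ^ s := by rw [pow_add, pow_mul]; norm_num
    _ ≤ m.centralBinom * (2 * Real.sqrt m) * 2 ^ s := by gcongr
    _ = (m.centralBinom * 2 ^ s) * (2 * Real.sqrt m) := by ring
    _ ≤ (2 * (2 * m + s).choose m) * (2 * Real.sqrt m) := by gcongr
    _ = _ := by ring

lemma prod_len_ge {t : ℕ} (ht : 1 ≤ t) (A : SCDData (Fin (4 * t ^ 2))) :
    t ^ (2 ^ (4 * t ^ 2 - 1)) ≤ ∏ i, (A.len i + 1).factorial := by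
  have hpos : 1 ≤ t ^ 2 := Nat.one_le_pow _ _ ht
  have h1 : ∏ i, t ^ (A.len i + 1) ≤ ∏ i, ((A.len i + 1).factorial * t ^ t) :=
    Finset.prod_le_prod' fun i _ => pow_le_factorial_mul _ _
  rw [Finset.prod_pow_eq_pow_sum, A.sum_len, Finset.prod_mul_distrib, Finset.prod_const,
    Finset.card_univ, A.card_index, Fintype.card_fin, ← pow_mul] at h1
  have h2 : 2 * t * (4 * t ^ 2).choose (4 * t ^ 2 / 2) ≤ 2 ^ (4 * t ^ 2) := by
    have e : 4 * t ^ 2 / 2 = 2 * t ^ 2 := by omega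
    have e2 : (4 * t ^ 2).choose (2 * t ^ 2) = (2 * t ^ 2).centralBinom := by
      rw [Nat.centralBinom]; congr 1; ring
    rw [e, e2]
    have := centralBinom_upper (2 * t ^ 2)
    refine (Nat.pow_le_pow_iff_left (n := 2) (by norm_num)).1 ?_
    calc (2 * t * (2 * t ^ 2).centralBinom)^2 = (2 * t ^ 2).centralBinom ^ 2 * (4 * t ^ 2) := by ring
      _ ≤ (2 * t ^ 2).centralBinom ^ 2 * (2 * (2 * t ^ 2) + 1) := by gcongr; omega
      _ ≤ _ := this
      _ = _ := by
        rw [← pow_mul, show 4 * t ^ 2 * 2 = 4 * (2 * t ^ 2) by ring, pow_mul 2]; norm_num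
  have h3 : 2 ^ (4 * t ^ 2) = 2 ^ (4 * t ^ 2 - 1) + 2 ^ (4 * t ^ 2 - 1) := by
    rw [← two_mul, ← pow_succ']; congr 1; omega
  rw [h3] at h1 h2
  rw [pow_add] at h1
  have h4 : t ^ (t * (4 * t ^ 2).choose (4 * t ^ 2 / 2)) ≤ t ^ (2 ^ (4 * t ^ 2 - 1)) := by
    apply Nat.pow_le_pow_right ht
    linarith
  exact Nat.le_of_mul_le_mul_right (h1.trans (Nat.mul_le_mul_left _ h4)) (by positivity)

lemma count_ge_pow {t m s n : ℕ} (ht : 1 ≤ t) (hs : 4 * t ^ 2 ≤ s)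
    (hn : 4 * t ^ 2 + (2 * m + s) = n) :
    t ^ (2 ^ (4 * t ^ 2 - 1) * (2 * m + s).choose m) ≤
      Nat.card {P : Finset (Finset (Finset (Fin n))) //
          IsSymmetricChainDecomposition n P ∧ P.card = n.choose (n / 2)} := by
  classical
  obtain ⟨A⟩ := SCDData.exists_fin (4 * t ^ 2)
  obtain ⟨B⟩ := SCDData.exists_fin (2 * m + s)
  refine le_trans ?_ (SCDData.count_ge hn A B)
  rw [Fintype.prod_prod_type_right]
  have hl := B.card_long m (by rw [Fintype.card_fin]; omega)
  rw [Fintype.card_fin] at hl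
  rw [← hl, pow_mul, ← Finset.prod_const]
  refine le_trans ?_ (Finset.prod_le_prod_of_subset_of_one_le'
    (Finset.filter_subset (fun j => B.m j ≤ m) Finset.univ) ?_)
  · apply Finset.prod_le_prod'
    intro j hj
    have hj := (Finset.mem_filter.1 hj).2
    refine (prod_len_ge ht A).trans (Finset.prod_le_prod' ?_)
    intro i _
    have h1 := A.hlen i
    have h2 := B.hlen j
    rw [Fintype.card_fin] at h1 h2
    rw [min_eq_left (by simp only; omega)]
  · intro j _ _
    exact Finset.one_le_prod' fun i _ => Nat.factorial_pos _

lemma exists_t (n : ℕ) (hn : 8 ^ 8 ≤ n) : ∃ t : ℕ, 1 ≤ t ∧ 256 * t ^ 4 ≤ n ∧ n ≤ t ^ 8 := by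
  have hex : ∃ t : ℕ, n < 256 * (t+1) ^ 4 := ⟨n, by
    have : n + 1 ≤ (n+1)^4 := Nat.le_self_pow (by norm_num) _
    omega⟩
  have h1 := Nat.find_spec hex
  have h2 : ∀ k < Nat.find hex, 256 * (k+1)^4 ≤ n := fun k hk => not_lt.1 (Nat.find_min hex hk)
  set t := Nat.find hex
  have h8 : 8 ≤ t := by
    by_contra h
    have : (t+1)^4 ≤ 8^4 := Nat.pow_le_pow_left (by omega) _
    omega
  refine ⟨t, by omega, ?_, ?_⟩
  · have := h2 (t-1) (by omega)
    rwa [show t - 1 + 1 = t by omega] at this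
  · have h3 : (t+1)^4 ≤ (2*t)^4 := Nat.pow_le_pow_left (by omega) _
    have h4 : 8 ^ 4 * t ^ 4 ≤ t ^ 4 * t ^ 4 := Nat.mul_le_mul_right _ (Nat.pow_le_pow_left h8 _)
    have e1 : (2*t)^4 = 16 * t^4 := by ring
    have e2 : t ^ 8 = t ^ 4 * t ^ 4 := by ring
    omega

/-- `2^[n]` has at least `2^(c·2^n·log n/√n)` partitions into
`C(n,⌊n/2⌋)` symmetric chains, for some `c > 0` and all large `n`. -/
theorem stmt_3 :
    ∃ c : ℝ, 0 < c ∧ ∃ N : ℕ, ∀ n : ℕ, N ≤ n →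
      (2 : ℝ) ^ (c * 2 ^ n * Real.log n / Real.sqrt n) ≤
        (Nat.card {P : Finset (Finset (Finset (Fin n))) //
          IsSymmetricChainDecomposition n P ∧ P.card = n.choose (n / 2)} : ℝ) := by
  refine ⟨1/64, by norm_num, 8 ^ 8, fun n hn => ?_⟩
  obtain ⟨t, ht, htn, hnt⟩ := exists_t n hn
  obtain ⟨m, s, hs1, hs2, hmn⟩ : ∃ m s : ℕ, 4 * t ^ 2 ≤ s ∧ s ≤ 4 * t ^ 2 + 1 ∧
      4 * t ^ 2 + (2 * m + s) = n := by
    have : t ^ 2 ≤ t ^ 4 := Nat.pow_le_pow_right ht (by norm_num)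
    refine ⟨(n - 8 * t ^ 2) / 2, 4 * t ^ 2 + (n - 8 * t ^ 2) % 2, by omega, by omega, by omega⟩
  have htt : t ^ 2 ≤ t ^ 4 := Nat.pow_le_pow_right ht (by norm_num)
  have hpos : 1 ≤ t ^ 2 := Nat.one_le_pow _ _ ht
  have hm1 : 1 ≤ m := by omega
  have hsm : s ^ 2 ≤ m := by
    have h1 : s ^ 2 ≤ (5 * t ^ 2) ^ 2 := Nat.pow_le_pow_left (by omega) _
    have h2 : (5 * t ^ 2) ^ 2 = 25 * t ^ 4 := by ring
    omega
  have hlow := choose_lower m s hm1 hsm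
  have hcount := count_ge_pow ht hs1 hmn
  set E := 2 ^ (4 * t ^ 2 - 1) * (2 * m + s).choose m with hE
  have hcount' : ((t ^ E : ℕ) : ℝ) ≤ (Nat.card {P : Finset (Finset (Finset (Fin n))) //
          IsSymmetricChainDecomposition n P ∧ P.card = n.choose (n / 2)} : ℝ) := by
    exact_mod_cast hcount
  refine le_trans ?_ hcount'
  have hn0 : (0:ℝ) < n := by
    have : 0 < n := by omega
    exact_mod_cast this
  have ht0 : (0:ℝ) < t := by exact_mod_cast ht
  have hsq : 0 < Real.sqrt n := Real.sqrt_pos.2 hn0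
  have hmn' : Real.sqrt m ≤ Real.sqrt n := Real.sqrt_le_sqrt (by
    have : m ≤ n := by omega
    exact_mod_cast this)
  have hEn : (2:ℝ) ^ n / (8 * Real.sqrt n) ≤ E := by
    rw [div_le_iff₀ (by positivity)]
    have e : n = (4 * t ^ 2 - 1) + 1 + (2 * m + s) := by omega
    calc (2:ℝ) ^ n = 2 ^ (4 * t ^ 2 - 1) * 2 * 2 ^ (2 * m + s) := by
          rw [← pow_succ, ← pow_add, ← e]
      _ ≤ 2 ^ (4 * t ^ 2 - 1) * 2 * ((2 * m + s).choose m * (4 * Real.sqrt m)) := by gcongr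
      _ ≤ 2 ^ (4 * t ^ 2 - 1) * 2 * ((2 * m + s).choose m * (4 * Real.sqrt n)) := by gcongr
      _ = E * (8 * Real.sqrt n) := by rw [hE]; push_cast; ring
  have hlogn : Real.log n ≤ 8 * Real.log t := by
    have h : (n:ℝ) ≤ (t:ℝ) ^ 8 := by exact_mod_cast hnt
    calc Real.log n ≤ Real.log ((t:ℝ)^8) := Real.log_le_log hn0 h
      _ = _ := by rw [Real.log_pow]; norm_num
  have hlogt : 0 ≤ Real.log t := Real.log_natCast_nonneg t
  have hlogn0 : 0 ≤ Real.log n := Real.log_natCast_nonneg n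
  have hx : 0 ≤ 1 / 64 * 2 ^ n * Real.log n / Real.sqrt n := by positivity
  calc (2 : ℝ) ^ (1 / 64 * 2 ^ n * Real.log n / Real.sqrt n)
      ≤ (Real.exp 1) ^ (1 / 64 * 2 ^ n * Real.log n / Real.sqrt n) := by
        apply Real.rpow_le_rpow (by norm_num) _ hx
        have := Real.add_one_le_exp 1
        linarith
    _ = Real.exp (1 / 64 * 2 ^ n * Real.log n / Real.sqrt n) := by rw [Real.exp_one_rpow]
    _ ≤ Real.exp (E * Real.log t) := by
        apply Real.exp_le_exp.2
        calc 1 / 64 * 2 ^ n * Real.log n / Real.sqrt n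
            = (2 ^ n / (8 * Real.sqrt n)) * (Real.log n / 8) := by field_simp; ring
          _ ≤ E * Real.log t := by
            apply mul_le_mul hEn (by linarith) (by positivity) (by positivity)
    _ = ((t ^ E : ℕ) : ℝ) := by
        rw [← Real.log_pow, Real.exp_log (by positivity)]
        push_cast
        rfl
end

section
/- For every positive integer n there exists a bijection p from the family of subsets of [n] of size ≥ n/2 to the family of subsets of size ≤ n/2, together with a partial order < on the domain of p, such that: (i) x < y implies x ⊆ y; (ii) whenever C is a chain with respect to <, the set C ∪ p(C) is a rank-symmetric chain in (2^[n], ⊆); and (iii) the poset ([n]^(≥n/2), <) has the normalized matching property. -/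
/-- A rank-symmetric chain in `2^[n]` (as a set of subsets): a chain under inclusion
whose set of cardinalities is invariant under `c ↦ n - c`. -/
def IsRankSymmetricChainSet (n : ℕ) (S : Set (Finset (Fin n))) : Prop :=
  (∀ x ∈ S, ∀ y ∈ S, x ⊆ y ∨ y ⊆ x) ∧
  (fun c => n - c) '' (Finset.card '' S) = Finset.card '' S

set_option linter.unusedSectionVars false

namespace RankSym

open Finset

section Cyc

variable {α : Type} [Fintype α] [DecidableEq α]

/-- sign of a position -/
def sg (x : Finset α) (a : α) : ℤ := if a ∈ x then 1 else -1

/-- arc sum of length `l` starting in `w` and following `f` -/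
def S (f : Equiv.Perm α) (x : Finset α) (w : α) (l : ℕ) : ℤ :=
  ∑ i ∈ range l, sg x ((f ^ i) w)

open Classical in
/-- cyclically unmatched ones -/
noncomputable def U (f : Equiv.Perm α) (x : Finset α) : Finset α :=
  univ.filter (fun w => ∀ l, 1 ≤ l → l ≤ Fintype.card α → 0 < S f x w l)

def Cyc (f : Equiv.Perm α) : Prop := ∀ a b, ∃ i < Fintype.card α, (f ^ i) a = b

lemma mem_U {f : Equiv.Perm α} {x : Finset α} {w : α} :
    w ∈ U f x ↔ ∀ l, 1 ≤ l → l ≤ Fintype.card α → 0 < S f x w l := by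
  simp [U]

lemma S_zero (f : Equiv.Perm α) (x w) : S f x w 0 = 0 := by simp [S]

lemma S_one (f : Equiv.Perm α) (x w) : S f x w 1 = sg x w := by simp [S]

lemma S_add (f : Equiv.Perm α) (x : Finset α) (w : α) (a b : ℕ) :
    S f x w (a + b) = S f x w a + S f x ((f ^ a) w) b := by
  unfold S
  rw [sum_range_add]
  congr 1
  apply sum_congr rfl
  intro i _
  rw [← Equiv.Perm.mul_apply, ← pow_add, add_comm]

lemma S_succ (f : Equiv.Perm α) (x : Finset α) (w : α) (a : ℕ) :
    S f x w (a + 1) = S f x w a + sg x ((f ^ a) w) := by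
  rw [S_add, S_one]

lemma S_succ' (f : Equiv.Perm α) (x : Finset α) (w : α) (a : ℕ) :
    S f x w (a + 1) = sg x w + S f x (f w) a := by
  rw [add_comm, S_add, S_one, pow_one]

lemma sg_mono {x y : Finset α} (h : x ⊆ y) (a : α) : sg x a ≤ sg y a := by
  unfold sg
  have := @h a
  split_ifs <;> simp_all

lemma S_mono (f : Equiv.Perm α) {x y : Finset α} (h : x ⊆ y) (w : α) (l : ℕ) :
    S f x w l ≤ S f y w l := sum_le_sum fun _ _ => sg_mono h _

lemma U_mono (f : Equiv.Perm α) {x y : Finset α} (h : x ⊆ y) : U f x ⊆ U f y := by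
  intro w hw
  rw [mem_U] at *
  exact fun l h1 h2 => (hw l h1 h2).trans_le (S_mono f h w l)

lemma U_sub (f : Equiv.Perm α) (x : Finset α) : U f x ⊆ x := by
  intro w hw
  rw [mem_U] at hw
  have := hw 1 le_rfl (Fintype.card_pos_iff.mpr ⟨w⟩)
  rw [S_one] at this
  by_contra h
  simp [sg, h] at this

lemma S_congr (f : Equiv.Perm α) {x y : Finset α} (w : α) (l : ℕ)
    (h : ∀ i < l, ((f ^ i) w ∈ x ↔ (f ^ i) w ∈ y)) : S f x w l = S f y w l := by
  unfold S
  apply sum_congr rfl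
  intro i hi
  simp only [sg, h i (mem_range.mp hi)]

lemma Cyc.inj {f : Equiv.Perm α} (hf : Cyc f) (a : α) {i j : ℕ} (hi : i < Fintype.card α)
    (hj : j < Fintype.card α) (h : (f ^ i) a = (f ^ j) a) : i = j := by
  have hs : Function.Surjective (fun i : Fin (Fintype.card α) => (f ^ (i : ℕ)) a) := by
    intro b
    obtain ⟨i, hi, h⟩ := hf a b
    exact ⟨⟨i, hi⟩, h⟩
  have hb := (Fintype.bijective_iff_surjective_and_card _).mpr ⟨hs, by simp⟩
  have := @hb.1 ⟨i, hi⟩ ⟨j, hj⟩ h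
  simpa using this

lemma Cyc.inv {f : Equiv.Perm α} (hf : Cyc f) : Cyc f⁻¹ := by
  intro a b
  obtain ⟨i, hi, h⟩ := hf b a
  refine ⟨i, hi, ?_⟩
  rw [inv_pow, Equiv.Perm.inv_eq_iff_eq, h]

lemma sum_sg (x : Finset α) : ∑ a, sg x a = 2 * (x.card : ℤ) - Fintype.card α := by
  have : ∀ a, sg x a = 2 * (if a ∈ x then 1 else 0) - 1 := by
    intro a; unfold sg; split_ifs <;> simp
  simp only [this, sum_sub_distrib, ← mul_sum]
  simp

lemma S_full {f : Equiv.Perm α} (hf : Cyc f) (x : Finset α) (w : α) :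
    S f x w (Fintype.card α) = 2 * (x.card : ℤ) - Fintype.card α := by
  rw [← sum_sg]
  unfold S
  apply sum_bij (fun i _ => (f ^ i) w)
  · simp
  · intro i hi j hj h
    exact hf.inj w (mem_range.mp hi) (mem_range.mp hj) h
  · intro b _
    obtain ⟨i, hi, h⟩ := hf w b
    exact ⟨i, mem_range.mpr hi, h⟩
  · simp

/-- the excess: running maximum minus current height -/
def ex (f : Equiv.Perm α) (x : Finset α) (w : α) : ℕ :=
  (range (Fintype.card α)).sup (fun l => (- S f x w l).toNat)

lemma ex_rec {f : Equiv.Perm α} (hf : Cyc f) (x : Finset α)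
    (hx : Fintype.card α ≤ 2 * x.card) (w : α) :
    (ex f x w : ℤ) = ex f x (f w) - sg x w + (if w ∈ U f x then 1 else 0) := by
  have hpos : 0 < Fintype.card α := Fintype.card_pos_iff.mpr ⟨w⟩
  have le_ex : ∀ (u : α) l, l < Fintype.card α → - S f x u l ≤ ex f x u := by
    intro u l hl
    have := le_sup (f := fun l => (- S f x u l).toNat) (mem_range.mpr hl)
    unfold ex
    have h2 := Int.self_le_toNat (- S f x u l)
    omega
  have ex_at : ∀ (u : α), ∃ l < Fintype.card α, (ex f x u : ℤ) = - S f x u l := by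
    intro u
    obtain ⟨l, hl, h⟩ := exists_mem_eq_sup (range (Fintype.card α)) ⟨0, mem_range.mpr hpos⟩
      (fun l => (- S f x u l).toNat)
    by_cases h0 : 0 ≤ - S f x u l
    · exact ⟨l, mem_range.mp hl, by unfold ex; rw [h]; simp [Int.toNat_of_nonneg h0]⟩
    · refine ⟨0, hpos, ?_⟩
      unfold ex; rw [h, S_zero]; simp; omega
  have hfull := S_full hf x w
  have le_ex' : ∀ l, l ≤ Fintype.card α → - S f x w l ≤ ex f x w := by
    intro l hl
    rcases hl.lt_or_eq with h | h
    · exact le_ex w l h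
    · subst h; omega
  obtain ⟨l1, hl1, e1⟩ := ex_at w
  obtain ⟨l2, hl2, e2⟩ := ex_at (f w)
  have a1 := le_ex' (l2 + 1) hl2
  rw [S_succ'] at a1
  split_ifs with hU
  · have hw := mem_U.mp hU
    have hwx := U_sub f x hU
    have b := hw (l2 + 1) (by omega) hl2
    rw [S_succ'] at b
    have : ex f x w = 0 := by
      rcases Nat.eq_zero_or_pos l1 with h | h
      · subst h; rw [S_zero] at e1; omega
      · have := hw l1 h hl1.le; omega
    have : sg x w = 1 := by simp [sg, hwx]
    omega
  · rw [mem_U] at hU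
    push Not at hU
    obtain ⟨l, h1, h2, h3⟩ := hU
    obtain ⟨m, rfl⟩ : ∃ m, l = m + 1 := ⟨l - 1, by omega⟩
    rw [S_succ'] at h3
    have c := le_ex (f w) m (by omega)
    rcases Nat.eq_zero_or_pos l1 with h | h
    · subst h; rw [S_zero] at e1; omega
    · obtain ⟨m1, rfl⟩ : ∃ m, l1 = m + 1 := ⟨l1 - 1, by omega⟩
      rw [S_succ'] at e1
      have := le_ex (f w) m1 (by omega)
      omega

lemma card_U {f : Equiv.Perm α} (hf : Cyc f) (x : Finset α)
    (hx : Fintype.card α ≤ 2 * x.card) : ((U f x).card : ℤ) = 2 * x.card - Fintype.card α := by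
  have h := sum_congr (rfl : (univ : Finset α) = univ) (fun w _ => ex_rec hf x hx w)
  rw [sum_add_distrib, sum_sub_distrib, sum_sg, Equiv.sum_comp f (fun w => (ex f x w : ℤ))] at h
  simp at h
  omega

/-- the bijection -/
noncomputable def p (f : Equiv.Perm α) (x : Finset α) : Finset α := x \ U f x

lemma keyF (f : Equiv.Perm α) (x : Finset α) (l : ℕ) :
    ∀ t, (f ^ l) t ∈ U f x → S f (p f x) t l ≤ 0 := by
  induction l using Nat.strong_induction_on with
  | _ l ih =>
    intro t ht
    by_contra hcon
    push Not at hcon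
    have hpos : ∀ j, 1 ≤ j → j ≤ l → 0 < S f (p f x) t j := by
      intro j h1 h2
      have e := S_add f (p f x) t j (l - j)
      rw [Nat.add_sub_cancel' h2] at e
      have := ih (l - j) (by omega) ((f ^ j) t) (by
        rw [← Equiv.Perm.mul_apply, ← pow_add, Nat.sub_add_cancel h2]; exact ht)
      omega
    have hl : 1 ≤ l := by
      rcases Nat.eq_zero_or_pos l with h | h
      · subst h; rw [S_zero] at hcon; omega
      · exact h
    have ht1 := hpos 1 le_rfl hl
    rw [S_one] at ht1
    have htp : t ∈ p f x := by
      by_contra h; simp [sg, h] at ht1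
    have htU : t ∉ U f x := (mem_sdiff.mp htp).2
    apply htU
    rw [mem_U]
    have hmono := fun j => S_mono f (sdiff_subset : x \ U f x ⊆ x) t j
    intro j h1 h2
    by_cases hj : j ≤ l
    · exact (hpos j h1 hj).trans_le (hmono j)
    · have e := S_add f x t l (j - l)
      rw [Nat.add_sub_cancel' (by omega)] at e
      have := mem_U.mp ht (j - l) (by omega) (by omega)
      have h3 := hpos l hl le_rfl
      have h4 := hmono l
      unfold p at h3
      omega

lemma card_p {f : Equiv.Perm α} (hf : Cyc f) (x : Finset α)
    (hx : Fintype.card α ≤ 2 * x.card) : (p f x).card = Fintype.card α - x.card := by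
  have h := card_U hf x hx
  have h2 := card_sdiff_add_card_eq_card (U_sub f x)
  have h3 := card_le_univ x
  unfold p
  omega

lemma U_eq {f : Equiv.Perm α} (hf : Cyc f) (x : Finset α)
    (hx : Fintype.card α ≤ 2 * x.card) : U f x = U f⁻¹ (p f x)ᶜ := by
  have h3 := card_le_univ x
  have hcp := card_p hf x hx
  have hcc := card_compl (p f x)
  apply eq_of_subset_of_card_le
  · intro v hv
    rw [mem_U]
    intro l h1 h2
    obtain ⟨m, rfl⟩ : ∃ m, l = m + 1 := ⟨l - 1, by omega⟩
    have hk := keyF f x m ((f⁻¹ ^ m) v) (by simpa [inv_pow] using hv)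
    have e : S f⁻¹ (p f x)ᶜ v (m + 1) = - S f (p f x) ((f⁻¹ ^ m) v) (m + 1) := by
      unfold S
      rw [← sum_range_reflect, ← sum_neg_distrib]
      apply sum_congr rfl
      intro i hi
      have hi := mem_range.mp hi
      have : (f ^ i) ((f⁻¹ ^ m) v) = (f⁻¹ ^ (m + 1 - 1 - i)) v := by
        obtain ⟨c, rfl⟩ : ∃ c, m = i + c := ⟨m - i, by omega⟩
        have : i + c + 1 - 1 - i = c := by omega
        rw [this, pow_add, Equiv.Perm.mul_apply, inv_pow, ← Equiv.Perm.mul_apply, mul_inv_cancel, Equiv.Perm.one_apply]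
      rw [this]
      unfold sg
      simp only [mem_compl]
      split_ifs <;> simp_all
    rw [e, S_succ]
    have : sg (p f x) ((f ^ m) ((f⁻¹ ^ m) v)) = -1 := by
      rw [inv_pow, ← Equiv.Perm.mul_apply, mul_inv_cancel, Equiv.Perm.one_apply]
      simp [sg, p, hv]
    omega
  · have a := card_U hf x hx
    have b := card_U hf.inv (p f x)ᶜ (by omega)
    omega

lemma p_inj {f : Equiv.Perm α} (hf : Cyc f) (x x' : Finset α)
    (hx : Fintype.card α ≤ 2 * x.card) (hx' : Fintype.card α ≤ 2 * x'.card)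
    (h : p f x = p f x') : x = x' := by
  have e : ∀ x, x = p f x ∪ U f x := fun x => (sdiff_union_of_subset (U_sub f x)).symm
  rw [e x, e x', U_eq hf x hx, U_eq hf x' hx', h]

def Rel (f : Equiv.Perm α) (y : Finset α) (w : α) (x : Finset α) (z : α) : Prop :=
  (∃ i, 1 ≤ i ∧ i < Fintype.card α ∧ (f ^ i) w ∈ U f y ∧ x = y.erase ((f ^ i) w) ∧
    ∀ i', 1 ≤ i' → i' < i → (f ^ i') w ∉ U f y) ∧ z ∉ x ∧
  ∃ j, (f ^ j) w = z ∧ S f x w (j + 1) = 0 ∧ ∀ j', 1 ≤ j' → j' ≤ j → 0 < S f x w j'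

lemma sg_ge (x : Finset α) (a : α) : -1 ≤ sg x a := by unfold sg; split_ifs <;> simp
lemma sg_le (x : Finset α) (a : α) : sg x a ≤ 1 := by unfold sg; split_ifs <;> simp

lemma S_le_zero (f : Equiv.Perm α) (y : Finset α) (t : α) (l : ℕ) (h : (f ^ l) t ∈ U f y)
    (h' : ∀ i < l, (f ^ i) t ∉ U f y) : S f y t l ≤ 0 := by
  have := keyF f y l t h
  rwa [S_congr f (y := y)] at this
  intro i hi
  simp [p, h' i hi]

lemma Rel_exists {f : Equiv.Perm α} (hf : Cyc f) (y : Finset α)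
    (hy : Fintype.card α + 2 ≤ 2 * y.card) (w : α) (hw : w ∈ y) : ∃ x z, Rel f y w x z := by
  have hc := card_U hf y (by omega)
  have hex : ∃ i, 1 ≤ i ∧ i < Fintype.card α ∧ (f ^ i) w ∈ U f y := by
    obtain ⟨v, hv, hne⟩ := exists_mem_ne (s := U f y) (by omega) w
    obtain ⟨i, hi, h⟩ := hf w v
    refine ⟨i, ?_, hi, h ▸ hv⟩
    rcases Nat.eq_zero_or_pos i with h0 | h0
    · subst h0; simp at h; exact absurd h.symm hne
    · exact h0
  classical
  obtain ⟨h1, h2, h3⟩ := Nat.find_spec hex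
  have hmin := fun m => @Nat.find_min _ _ hex m
  set i := Nat.find hex
  set v := (f ^ i) w with hvdef
  have hvw : w ≠ v := by
    intro h
    have := hf.inj w (i := 0) (j := i) (by omega) h2 (by simpa using h)
    omega
  have hni : ∀ i', 1 ≤ i' → i' < i → (f ^ i') w ∉ U f y := by
    intro i' a b c
    exact hmin i' b ⟨a, by omega, c⟩
  set x := y.erase v with hxdef
  have hxS : S f x w (i + 1) ≤ 0 := by
    have a1 : S f y w i ≤ 1 := by
      obtain ⟨m, hm⟩ : ∃ m, i = m + 1 := ⟨i - 1, by omega⟩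
      rw [hm, S_succ']
      have hp : ∀ c, (f ^ c) (f w) = (f ^ (c + 1)) w := by
        intro c; rw [pow_succ, Equiv.Perm.mul_apply]
      have := S_le_zero f y (f w) m (by rw [hp, ← hm]; exact h3)
        (by intro c hc; rw [hp]; exact hni _ (by omega) (by omega))
      have := sg_le y w
      omega
    have a2 : S f x w i ≤ S f y w i := S_mono f (erase_subset v y) w i
    rw [S_succ]
    have : sg x ((f ^ i) w) = -1 := by simp [sg, hxdef, hvdef]
    omega
  have hex2 : ∃ j, S f x w (j + 1) ≤ 0 := ⟨i, hxS⟩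
  have q1 := Nat.find_spec hex2
  have q2 := fun m => @Nat.find_min _ _ hex2 m
  set j := Nat.find hex2
  have hj' : ∀ j', 1 ≤ j' → j' ≤ j → 0 < S f x w j' := by
    intro j' a b
    have := q2 (j' - 1) (by omega)
    rw [Nat.sub_add_cancel a] at this
    omega
  have hwx : w ∈ x := mem_erase.mpr ⟨hvw, hw⟩
  have hj1 : 1 ≤ j := by
    rcases Nat.eq_zero_or_pos j with h0 | h0
    · rw [h0, zero_add, S_one] at q1; simp [sg, hwx] at q1
    · exact h0
  have hj2 := hj' j hj1 le_rfl
  have hs := S_succ f x w j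
  have hge := sg_ge x ((f ^ j) w)
  refine ⟨x, (f ^ j) w, ⟨i, h1, h2, h3, rfl, hni⟩, ?_, j, rfl, by omega, hj'⟩
  intro hmem
  have : sg x ((f ^ j) w) = 1 := by simp [sg, hmem]
  omega

lemma pow_sub_apply' (f : Equiv.Perm α) {i j : ℕ} (h : i ≤ j) (w : α) :
    (f ^ j) w = (f ^ (j - i)) ((f ^ i) w) := by
  rw [← Equiv.Perm.mul_apply, ← pow_add, Nat.sub_add_cancel h]

lemma Rel_w_aux {f : Equiv.Perm α} {x : Finset α} {w w' : α} {j j' : ℕ}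
    (e : (f ^ j) w = (f ^ j') w') (hjj : j ≤ j')
    (h0 : S f x w (j + 1) = 0)
    (h0' : S f x w' (j' + 1) = 0) (hp' : ∀ m, 1 ≤ m → m ≤ j' → 0 < S f x w' m) : w = w' := by
  have hw : w = (f ^ (j' - j)) w' := by
    apply (f ^ j).injective
    rw [e, ← Equiv.Perm.mul_apply, ← pow_add, Nat.add_sub_cancel' hjj]
  rcases hjj.lt_or_eq with h | h
  · exfalso
    have := S_add f x w' (j' - j) (j + 1)
    rw [← hw, show j' - j + (j + 1) = j' + 1 by omega] at this
    have := hp' (j' - j) (by omega) (by omega)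
    omega
  · subst h; simpa using hw

lemma Rel_v_aux {f : Equiv.Perm α} (hf : Cyc f) {x y y' : Finset α} {w : α} {i i' : ℕ}
    (hlt : i' < i) (hi' : 1 ≤ i') (hi : i < Fintype.card α)
    (hU : (f ^ i) w ∈ U f y) (hU' : (f ^ i') w ∈ U f y')
    (hx : x = y.erase ((f ^ i) w)) (hx' : x = y'.erase ((f ^ i') w))
    (hn : ∀ m, 1 ≤ m → m < i → (f ^ m) w ∉ U f y) : False := by
  set v := (f ^ i) w with hv
  set v' := (f ^ i') w with hv'
  obtain ⟨l, hl⟩ : ∃ l, i = i' + (l + 1) := ⟨i - i' - 1, by omega⟩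
  have hp : ∀ c, (f ^ c) (f v') = (f ^ (i' + (c + 1))) w := by
    intro c
    rw [hv', ← Equiv.Perm.mul_apply, ← Equiv.Perm.mul_apply, ← pow_succ, ← pow_add, add_comm]
  have a := S_le_zero f y (f v') l (by rw [hp, ← hl]; exact hU)
    (by intro c hc; rw [hp]; exact hn _ (by omega) (by omega))
  have b : S f x (f v') l ≤ S f y (f v') l := S_mono f (hx ▸ erase_subset _ _) _ _
  have c : S f x (f v') (l + 1) = S f y' (f v') (l + 1) := by
    apply S_congr
    intro m hm
    rw [hx', mem_erase]
    constructor
    · exact fun h => h.2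
    · intro h
      refine ⟨?_, h⟩
      rw [hp, hv']
      intro heq
      have := hf.inj w (by omega) (by omega) heq
      omega
  have d : S f x (f v') (l + 1) ≤ -1 := by
    rw [S_succ, hp, ← hl]
    have : sg x ((f ^ i) w) = -1 := by simp [sg, hx, hv]
    omega
  have e := mem_U.mp hU' (l + 1 + 1) (by omega) (by omega)
  rw [S_succ'] at e
  have := sg_le y' v'
  omega

lemma Rel_inj {f : Equiv.Perm α} (hf : Cyc f) {x y y' : Finset α} {w w' z : α}
    (h : Rel f y w x z) (h' : Rel f y' w' x z) : y = y' ∧ w = w' := by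
  obtain ⟨⟨i, h1, h2, h3, h4, h5⟩, hz, j, g1, g2, g3⟩ := h
  obtain ⟨⟨i', h1', h2', h3', h4', h5'⟩, hz', j', g1', g2', g3'⟩ := h'
  have hw : w = w' := by
    rcases le_total j j' with h | h
    · exact Rel_w_aux (g1.trans g1'.symm) h g2 g2' g3'
    · exact (Rel_w_aux (g1'.trans g1.symm) h g2' g2 g3).symm
  subst hw
  refine ⟨?_, rfl⟩
  rcases lt_trichotomy i i' with h | h | h
  · exact (Rel_v_aux hf h h1 h2' h3' h3 h4' h4 h5').elim
  · subst h
    rw [← insert_erase (U_sub f y h3), ← insert_erase (U_sub f y' h3'), ← h4, ← h4']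
  · exact (Rel_v_aux hf h h1' h2 h3 h3' h4 h4' h5).elim

def lt (f : Equiv.Perm α) (x y : Finset α) : Prop := x ⊂ y ∧ p f y ⊆ p f x

lemma lt_trans' {f : Equiv.Perm α} {x y z : Finset α} (h : lt f x y) (h' : lt f y z) :
    lt f x z := ⟨h.1.trans h'.1, h'.2.trans h.2⟩

open Classical in
/-- lower shadow w.r.t. `lt` -/
noncomputable def dn (f : Equiv.Perm α) (j : ℕ) (Y : Finset (Finset α)) : Finset (Finset α) :=
  univ.filter (fun x => x.card = j ∧ ∃ y ∈ Y, lt f x y)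

lemma mem_dn {f : Equiv.Perm α} {j : ℕ} {Y : Finset (Finset α)} {x : Finset α} :
    x ∈ dn f j Y ↔ x.card = j ∧ ∃ y ∈ Y, lt f x y := by
  simp [dn]

lemma step {f : Equiv.Perm α} (hf : Cyc f) (k : ℕ) (hk : Fintype.card α ≤ 2 * k)
    (Y : Finset (Finset α)) (hY : ∀ y ∈ Y, y.card = k + 1) :
    Y.card * (k + 1) ≤ (dn f k Y).card * (Fintype.card α - k) := by
  classical
  have hA : (Y.sigma (fun y => y)).card = Y.card * (k + 1) := by
    rw [card_sigma, sum_congr rfl hY, sum_const, smul_eq_mul]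
  have hB : ((dn f k Y).sigma (fun x => xᶜ)).card = (dn f k Y).card * (Fintype.card α - k) := by
    rw [card_sigma, sum_congr rfl (g := fun _ => Fintype.card α - k), sum_const, smul_eq_mul]
    intro x hx
    rw [card_compl, (mem_filter.mp hx).2.1]
  rw [← hA, ← hB]
  have hR : ∀ a : (_ : Finset α) × α, ∃ b : (_ : Finset α) × α,
      a ∈ Y.sigma (fun y => y) → Rel f a.1 a.2 b.1 b.2 := by
    intro a
    by_cases h : a ∈ Y.sigma (fun y => y)
    · rw [mem_sigma] at h
      obtain ⟨x, z, hr⟩ := Rel_exists hf a.1 (by have := hY _ h.1; omega) a.2 h.2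
      exact ⟨⟨x, z⟩, fun _ => hr⟩
    · exact ⟨a, fun h' => absurd h' h⟩
  choose g hg using hR
  apply card_le_card_of_injOn g
  · intro a ha
    have hr := hg a ha
    have ha := mem_sigma.mp (mem_coe.mp ha)
    obtain ⟨⟨i, h1, h2, h3, h4, h5⟩, hz, -⟩ := hr
    rw [mem_coe, mem_sigma]
    have hm := U_sub f _ h3
    refine ⟨?_, mem_compl.mpr hz⟩
    unfold dn
    simp only [mem_filter, mem_univ, true_and]
    refine ⟨?_, a.1, ha.1, ?_, ?_⟩
    · rw [h4, card_erase_of_mem hm, hY _ ha.1]; rfl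
    · rw [h4]; exact erase_ssubset hm
    · intro t ht
      rw [p, mem_sdiff] at *
      have hsub : (g a).1 ⊆ a.1 := h4 ▸ erase_subset _ _
      refine ⟨?_, fun h => ht.2 (U_mono f hsub h)⟩
      rw [h4, mem_erase]
      exact ⟨fun h => ht.2 (h ▸ h3), ht.1⟩
  · intro a ha b hb hab
    have ra := hg a ha
    have rb := hg b hb
    rw [← hab] at rb
    obtain ⟨e1, e2⟩ := Rel_inj hf ra rb
    cases a; cases b; simp only at e1 e2; subst e1; subst e2; rfl

lemma nmp_down {f : Equiv.Perm α} (hf : Cyc f) (j : ℕ) (hj : Fintype.card α ≤ 2 * j) (m : ℕ) :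
    1 ≤ m → j + m ≤ Fintype.card α → ∀ Y : Finset (Finset α), (∀ y ∈ Y, y.card = j + m) →
    Y.card * (Fintype.card α).choose j ≤ (dn f j Y).card * (Fintype.card α).choose (j + m) := by
  classical
  have one : ∀ k, Fintype.card α ≤ 2 * k → ∀ Y : Finset (Finset α), (∀ y ∈ Y, y.card = k + 1) →
    Y.card * (Fintype.card α).choose k ≤ (dn f k Y).card * (Fintype.card α).choose (k + 1) := by
    intro k hk Y hY
    have h := step hf k hk Y hY
    have e := Nat.choose_succ_right_eq (Fintype.card α) k
    apply Nat.le_of_mul_le_mul_right (c := k + 1) _ (by omega)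
    calc _ = (Y.card * (k + 1)) * (Fintype.card α).choose k := by ring
      _ ≤ ((dn f k Y).card * (Fintype.card α - k)) * (Fintype.card α).choose k :=
        Nat.mul_le_mul_right _ h
      _ = (dn f k Y).card * ((Fintype.card α).choose k * (Fintype.card α - k)) := by ring
      _ = _ := by rw [← e]; ring
  induction m with
  | zero => intro h; omega
  | succ m ih =>
    intro _ hm Y hY
    rcases Nat.eq_zero_or_pos m with h0 | h0
    · subst h0; exact one j hj Y hY
    · have a := one (j + m) (by omega) Y hY
      have b := ih h0 (by omega) (dn f (j + m) Y) (fun y hy => (mem_dn.mp hy).1)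
      have c : (dn f j (dn f (j + m) Y)).card ≤ (dn f j Y).card := by
        apply card_le_card
        intro x hx
        rw [mem_dn] at hx ⊢
        obtain ⟨h1, y, hy, h4⟩ := hx
        obtain ⟨h2, z, hz, h3⟩ := mem_dn.mp hy
        exact ⟨h1, z, hz, lt_trans' h4 h3⟩
      have hpos : 0 < (Fintype.card α).choose (j + m) := Nat.choose_pos (by omega)
      apply Nat.le_of_mul_le_mul_right (c := (Fintype.card α).choose (j + m)) _ hpos
      rw [← add_assoc]
      calc _ = Y.card * (Fintype.card α).choose (j + m) * (Fintype.card α).choose j := by ring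
        _ ≤ (dn f (j + m) Y).card * (Fintype.card α).choose (j + m + 1)
            * (Fintype.card α).choose j := Nat.mul_le_mul_right _ a
        _ = ((dn f (j + m) Y).card * (Fintype.card α).choose j)
            * (Fintype.card α).choose (j + m + 1) := by ring
        _ ≤ ((dn f j (dn f (j + m) Y)).card * (Fintype.card α).choose (j + m))
            * (Fintype.card α).choose (j + m + 1) := Nat.mul_le_mul_right _ b
        _ ≤ ((dn f j Y).card * (Fintype.card α).choose (j + m))
            * (Fintype.card α).choose (j + m + 1) := by gcongr
        _ = _ := by ring

open Classical in
/-- neighbourhood in level `j` -/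
noncomputable def nb (f : Equiv.Perm α) (j : ℕ) (X : Finset (Finset α)) : Finset (Finset α) :=
  univ.filter (fun y => y.card = j ∧ ∃ x ∈ X, lt f x y ∨ lt f y x)

lemma nmp {f : Equiv.Perm α} (hf : Cyc f) (i j : ℕ) (hi : Fintype.card α ≤ 2 * i)
    (hi' : i ≤ Fintype.card α) (hj : Fintype.card α ≤ 2 * j) (hj' : j ≤ Fintype.card α)
    (hij : i ≠ j) (X : Finset (Finset α)) (hX : ∀ x ∈ X, x.card = i) :
    X.card * (Fintype.card α).choose j ≤ (nb f j X).card * (Fintype.card α).choose i := by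
  classical
  rcases lt_or_gt_of_ne hij with h | h
  · -- upward, by complementation
    set Y := (powersetCard j (univ : Finset α)) \ nb f j X with hYdef
    have hsub : nb f j X ⊆ powersetCard j (univ : Finset α) := by
      intro y hy
      exact mem_powersetCard.mpr ⟨subset_univ _, (mem_filter.mp hy).2.1⟩
    have hYc : Y.card + (nb f j X).card = (Fintype.card α).choose j := by
      rw [hYdef, card_sdiff_add_card_eq_card hsub, card_powersetCard, card_univ]
    have hY : ∀ y ∈ Y, y.card = i + (j - i) := by
      intro y hy
      rw [hYdef, mem_sdiff, mem_powersetCard] at hy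
      omega
    have a := nmp_down hf i hi (j - i) (by omega) (by omega) Y hY
    rw [Nat.add_sub_cancel' h.le] at a
    have hd : Disjoint (dn f i Y) X := by
      rw [disjoint_left]
      intro x hx hxX
      simp only [dn, mem_filter, mem_univ, true_and] at hx
      obtain ⟨h1, y, hy, h2⟩ := hx
      rw [hYdef, mem_sdiff, mem_powersetCard] at hy
      apply hy.2
      simp only [nb, mem_filter, mem_univ, true_and]
      exact ⟨hy.1.2, x, hxX, Or.inl h2⟩
    have hle : (dn f i Y).card + X.card ≤ (Fintype.card α).choose i := by
      rw [← card_union_of_disjoint hd, ← card_univ (α := α), ← card_powersetCard]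
      apply card_le_card
      intro x hx
      rw [mem_powersetCard]
      refine ⟨subset_univ _, ?_⟩
      rcases mem_union.mp hx with h | h
      · exact (mem_filter.mp h).2.1
      · exact hX x h
    generalize (Fintype.card α).choose i = ci at *
    generalize (Fintype.card α).choose j = cj at *
    have b := Nat.mul_le_mul_right cj hle
    have c : (Y.card + (nb f j X).card) * ci = cj * ci := by rw [hYc]
    nlinarith
  · have a := nmp_down hf j hj (i - j) (by omega) (by omega) X
      (by intro x hx; rw [hX x hx]; omega)
    rw [Nat.add_sub_cancel' h.le] at a
    refine a.trans (Nat.mul_le_mul_right _ (card_le_card ?_))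
    intro y hy
    simp only [dn, nb, mem_filter, mem_univ, true_and] at hy ⊢
    obtain ⟨h1, x, hx, h2⟩ := hy
    exact ⟨h1, x, hx, Or.inr h2⟩

lemma p_bij {f : Equiv.Perm α} (hf : Cyc f) :
    Set.BijOn (p f) {x | Fintype.card α ≤ 2 * x.card} {x | 2 * x.card ≤ Fintype.card α} := by
  have hmaps : Set.MapsTo (p f) {x | Fintype.card α ≤ 2 * x.card}
      {x | 2 * x.card ≤ Fintype.card α} := by
    intro x hx
    have := card_p hf x hx
    simp only [Set.mem_ofPred_eq] at *
    omega
  have hinj : Set.InjOn (p f) {x | Fintype.card α ≤ 2 * x.card} :=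
    fun x hx x' hx' h => p_inj hf x x' hx hx' h
  refine ⟨hmaps, hinj, ?_⟩
  have hc : ∀ x : Finset α, x.card ≤ Fintype.card α := card_le_univ
  have hcard : ({x : Finset α | 2 * x.card ≤ Fintype.card α}).ncard ≤
      ({x : Finset α | Fintype.card α ≤ 2 * x.card}).ncard := by
    apply Set.ncard_le_ncard_of_injOn (fun x => xᶜ)
    · intro x hx
      have := hc x
      simp only [Set.mem_ofPred_eq, card_compl] at *
      omega
    · intro x _ y _ h
      exact compl_injective h
  have := Set.eq_of_subset_of_ncard_le hmaps.image_subset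
    (by rw [hinj.ncard_image]; exact hcard)
  exact this.symm.subset

end Cyc

lemma cyc_rot (m : ℕ) : Cyc (finRotate (m + 1)) := by
  have h : ∀ (a : Fin (m + 1)) (i : ℕ), ((finRotate (m + 1)) ^ i) a = a + Fin.ofNat (m + 1) i := by
    intro a i
    induction i with
    | zero => ext; simp [Fin.val_add]
    | succ i ih =>
      rw [pow_succ', Equiv.Perm.mul_apply, ih, finRotate_apply]
      ext; simp [Fin.val_add, add_assoc]
  intro a b
  refine ⟨(b - a).val, by simpa using (b - a).isLt, ?_⟩
  rw [h]
  simp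

end RankSym

/-- there is a bijection `p : [n]^(≥n/2) → [n]^(≤n/2)` and a partial
order `<` on `[n]^(≥n/2)` such that (i) inclusion extends `<`; (ii) for every
`<`-chain `C`, the family `C ∪ p(C)` is a rank-symmetric chain in `2^[n]`;
(iii) `([n]^(≥n/2), <)` has the normalized matching property (between any two of
its levels). -/
theorem stmt_6 (n : ℕ) (hn : 1 ≤ n) :
    ∃ (p : Finset (Fin n) → Finset (Fin n)) (lt : Finset (Fin n) → Finset (Fin n) → Prop),
      Set.BijOn p {x | n ≤ 2 * x.card} {x | 2 * x.card ≤ n} ∧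
      (∀ a, ¬ lt a a) ∧ (∀ a b c, lt a b → lt b c → lt a c) ∧
      -- (i) inclusion extends <
      (∀ x y : Finset (Fin n), n ≤ 2 * x.card → n ≤ 2 * y.card → lt x y → x ⊆ y) ∧
      -- (ii) chains give rank-symmetric chains
      (∀ C : Set (Finset (Fin n)), C ⊆ {x | n ≤ 2 * x.card} →
        (∀ x ∈ C, ∀ y ∈ C, x = y ∨ lt x y ∨ lt y x) →
        IsRankSymmetricChainSet n (C ∪ p '' C)) ∧
      -- (iii) normalized matching property between any two levels of ([n]^(≥n/2), <)
      (∀ i j : ℕ, n ≤ 2 * i → i ≤ n → n ≤ 2 * j → j ≤ n → i ≠ j →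
        ∀ X ⊆ {x : Finset (Fin n) | x.card = i},
          X.ncard * n.choose j ≤
            {y : Finset (Fin n) | y.card = j ∧ ∃ x ∈ X, lt x y ∨ lt y x}.ncard *
              n.choose i) := by
  obtain ⟨m, rfl⟩ : ∃ m, n = m + 1 := ⟨n - 1, by omega⟩
  have hf := RankSym.cyc_rot m
  set f := finRotate (m + 1)
  have hcard : Fintype.card (Fin (m + 1)) = m + 1 := Fintype.card_fin _
  have hbij := RankSym.p_bij hf
  have hcp := RankSym.card_p hf
  have hnmp := RankSym.nmp hf
  rw [hcard] at hbij hcp hnmp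
  have hpsub : ∀ x, RankSym.p f x ⊆ x := fun x => Finset.sdiff_subset
  refine ⟨RankSym.p f, RankSym.lt f, hbij, fun a h => (ssubset_irrefl a) h.1,
    fun a b c h h' => RankSym.lt_trans' h h', fun x y _ _ h => h.1.subset, ?_, ?_⟩
  · intro C hC hch
    have hle : ∀ x : Finset (Fin (m + 1)), x.card ≤ m + 1 := fun x => by
      simpa using Finset.card_le_univ x
    constructor
    · have key : ∀ x ∈ C, ∀ y ∈ C, (x ⊆ y ∧ RankSym.p f y ⊆ RankSym.p f x) ∨
          (y ⊆ x ∧ RankSym.p f x ⊆ RankSym.p f y) := by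
        intro x hx y hy
        rcases hch x hx y hy with h | h | h
        · subst h; exact Or.inl ⟨subset_rfl, subset_rfl⟩
        · exact Or.inl ⟨h.1.subset, h.2⟩
        · exact Or.inr ⟨h.1.subset, h.2⟩
      rintro a (ha | ⟨x, hx, rfl⟩) b (hb | ⟨y, hy, rfl⟩)
      · rcases key a ha b hb with h | h
        · exact Or.inl h.1
        · exact Or.inr h.1
      · rcases key a ha y hy with h | h
        · exact Or.inr (h.2.trans (hpsub a))
        · exact Or.inr ((hpsub y).trans h.1)
      · rcases key x hx b hb with h | h
        · exact Or.inl ((hpsub x).trans h.1)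
        · exact Or.inl (h.2.trans (hpsub b))
      · rcases key x hx y hy with h | h
        · exact Or.inr h.2
        · exact Or.inl h.2
    · ext c
      constructor
      · rintro ⟨_, ⟨a, ha | ⟨x, hx, rfl⟩, rfl⟩, rfl⟩
        · exact ⟨RankSym.p f a, Or.inr ⟨a, ha, rfl⟩, hcp a (hC ha)⟩
        · refine ⟨x, Or.inl hx, ?_⟩
          have := hcp x (hC hx)
          have := hle x
          simp only
          omega
      · rintro ⟨a, ha | ⟨x, hx, rfl⟩, rfl⟩
        · refine ⟨_, ⟨RankSym.p f a, Or.inr ⟨a, ha, rfl⟩, rfl⟩, ?_⟩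
          have := hcp a (hC ha)
          have := hle a
          simp only
          omega
        · exact ⟨_, ⟨x, Or.inl hx, rfl⟩, (hcp x (hC hx)).symm⟩
  · intro i j hi hi' hj hj' hij X hX
    classical
    have hXf := Set.toFinite X
    have h := hnmp i j hi hi' hj hj' hij hXf.toFinset
      (fun x hx => hX (hXf.mem_toFinset.mp hx))
    rw [Set.ncard_eq_toFinset_card X hXf]
    have e : {y : Finset (Fin (m + 1)) | y.card = j ∧
        ∃ x ∈ X, RankSym.lt f x y ∨ RankSym.lt f y x} = ↑(RankSym.nb f j hXf.toFinset) := by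
      ext y
      simp [RankSym.nb]
    rw [e, Set.ncard_coe_finset]
    exact h
end
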